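/- arXiv:1912.05739 — 2 statements merged into one kernel-verified Lean document; each statement's English description precedes it below -/
import Mathlib

section
/- Let (G_{k,k−1}, G_{k,N}, G_k), k ∈ [1,N−1], be parameters of a CM_L model satisfying the reciprocity condition G_k⁻¹ G_{k,N} = G_{k+1,k}' G_{k+1}⁻¹ G_{k+1,N} for all k ∈ [1,N−2]. Then for any d×d positive definite matrices G_0 and G_N, the zero-mean nonsingular Gaussian sequence [x_k] generated by this CM_L model with boundary parameter G_{0,N} = G_0 G_{1,0}' G_1⁻¹ G_{1,N} is Markov. In particular, the set of reciprocal sequences modeled by a given reciprocal CM_L model contains Markov sequences. -/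
open MeasureTheory ProbabilityTheory Matrix
open scoped NNReal

namespace CMSeqPaper

variable {Ω : Type*} [MeasurableSpace Ω]

/-- Square `d × d` real matrices. -/
abbrev Mat (d : ℕ) := Matrix (Fin d) (Fin d) ℝ

/-- `X` is a zero-mean jointly Gaussian random vector with covariance matrix `C`
(Cramér–Wold characterization: every linear functional of `X` is a centered real
Gaussian with the induced variance). -/
def IsZeroMeanGaussian {ι : Type*} [Fintype ι] (μ : Measure Ω)
    (X : Ω → ι → ℝ) (C : Matrix ι ι ℝ) : Prop :=
  ∀ l : ι → ℝ,
    μ.map (fun ω => ∑ i, l i * X ω i) = gaussianReal 0 (l ⬝ᵥ C.mulVec l).toNNReal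

/-- The stacked vector over times `0, …, N` of a `d`-dimensional sequence. -/
def stack (N d : ℕ) (x : ℕ → Ω → Fin d → ℝ) : Ω → Fin (N + 1) × Fin d → ℝ :=
  fun ω p => x (p.1 : ℕ) ω p.2

/-- `[x_k]`, `k ∈ [0,N]`, is a zero-mean nonsingular Gaussian sequence whose stacked
vector has (positive definite) covariance matrix `C`. -/
def ZMNG (N d : ℕ) (μ : Measure Ω) (x : ℕ → Ω → Fin d → ℝ)
    (C : Matrix (Fin (N + 1) × Fin d) (Fin (N + 1) × Fin d) ℝ) : Prop :=
  (∀ k, k ≤ N → Measurable (x k)) ∧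
    IsZeroMeanGaussian μ (stack N d x) C ∧ C.PosDef

/-- The σ-algebra generated by the states at the times in `S`. -/
def sigmaOf {d : ℕ} (x : ℕ → Ω → Fin d → ℝ) (S : Set ℕ) : MeasurableSpace Ω :=
  ⨆ i ∈ S, MeasurableSpace.comap (x i) inferInstance

/-- The conditional distribution of `x k` given the states at the times in `S`
coincides (a.e.) with the conditional distribution of `x k` given the states at the
times in `T`. -/
def CondEq {d : ℕ} (μ : Measure Ω) (x : ℕ → Ω → Fin d → ℝ) (k : ℕ)
    (S T : Set ℕ) : Prop :=
  ∀ A : Set (Fin d → ℝ), MeasurableSet A →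
    μ[A.indicator (fun _ => (1 : ℝ)) ∘ x k | sigmaOf x S]
      =ᵐ[μ] μ[A.indicator (fun _ => (1 : ℝ)) ∘ x k | sigmaOf x T]

/-- `[x_k]` is `[k₁,k₂]`-CM_c: for all `k₁ ≤ j < k ≤ k₂`, the conditional
distribution of `x k` given `(x_{k₁}, …, x_j, x_c)` equals the one given `(x_j, x_c)`. -/
def IsCM {d : ℕ} (μ : Measure Ω) (x : ℕ → Ω → Fin d → ℝ) (k₁ k₂ c : ℕ) : Prop :=
  ∀ j k, k₁ ≤ j → j < k → k ≤ k₂ →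
    CondEq μ x k (Set.Icc k₁ j ∪ {c}) ({j} ∪ {c})

/-- `[x_k]` is Markov on the index interval `[a,b]`. -/
def IsMarkovOn {d : ℕ} (μ : Measure Ω) (x : ℕ → Ω → Fin d → ℝ) (a b : ℕ) : Prop :=
  ∀ j k, a ≤ j → j < k → k ≤ b → CondEq μ x k (Set.Icc a j) {j}

/-- `[x_k]` is reciprocal on `[0,N]`. -/
def IsReciprocal {d : ℕ} (μ : Measure Ω) (x : ℕ → Ω → Fin d → ℝ) (N : ℕ) : Prop :=
  ∀ j k l, j < k → k < l → l ≤ N →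
    CondEq μ x k (Set.Icc 0 j ∪ Set.Icc l N) ({j} ∪ {l})

/-- Block `(i,j)` of the block matrix `A` is zero. -/
def BlockZero {n d : ℕ} (A : Matrix (Fin n × Fin d) (Fin n × Fin d) ℝ)
    (i j : Fin n) : Prop :=
  ∀ a b, A (i, a) (j, b) = 0

/-- `|i - j| ≥ 2` for block indices. -/
def Far {n : ℕ} (i j : Fin n) : Prop :=
  (i : ℕ) + 2 ≤ (j : ℕ) ∨ (j : ℕ) + 2 ≤ (i : ℕ)

/-- Block tri-diagonal: every block `(i,j)` with `|i-j| ≥ 2` is zero. -/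
def BlockTriDiag {n d : ℕ} (A : Matrix (Fin n × Fin d) (Fin n × Fin d) ℝ) : Prop :=
  ∀ i j, Far i j → BlockZero A i j

/-- The CM_L form: every block `(i,j)` with `|i-j| ≥ 2` is zero except possibly
blocks in the last block row and last block column. -/
def HasCMLForm {n d : ℕ} (A : Matrix (Fin n × Fin d) (Fin n × Fin d) ℝ) : Prop :=
  ∀ i j, Far i j → (i : ℕ) ≠ n - 1 → (j : ℕ) ≠ n - 1 → BlockZero A i j

/-- The CM_F form: every block `(i,j)` with `|i-j| ≥ 2` is zero except possibly
blocks in the first block row and first block column. -/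
def HasCMFForm {n d : ℕ} (A : Matrix (Fin n × Fin d) (Fin n × Fin d) ℝ) : Prop :=
  ∀ i j, Far i j → (i : ℕ) ≠ 0 → (j : ℕ) ≠ 0 → BlockZero A i j

/-- Cyclic block tri-diagonal: every block `(i,j)` with `|i-j| ≥ 2` is zero except
possibly the corner blocks `(0, n-1)` and `(n-1, 0)`. -/
def CyclicBlockTriDiag {n d : ℕ} (A : Matrix (Fin n × Fin d) (Fin n × Fin d) ℝ) : Prop :=
  ∀ i j, Far i j → ¬((i : ℕ) = 0 ∧ (j : ℕ) = n - 1) →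
    ¬((i : ℕ) = n - 1 ∧ (j : ℕ) = 0) → BlockZero A i j

/-- The stacked block-diagonal matrix with diagonal blocks `G 0, …, G N`. -/
def blockDiag (N d : ℕ) (G : ℕ → Mat d) :
    Matrix (Fin (N + 1) × Fin d) (Fin (N + 1) × Fin d) ℝ :=
  fun p q => if (p.1 : ℕ) = (q.1 : ℕ) then G (p.1 : ℕ) p.2 q.2 else 0

/-- `[x_k]` obeys the CM_L model with parameters `Gm k = G_{k,k-1}` and
`GN k = G_{k,N}` for `k ∈ [1,N-1]`, boundary parameter `GN 0 = G_{0,N}`, and noise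
covariances `Gcov k = G_k = Cov(e_k)`: the `e_k` are zero-mean jointly Gaussian,
mutually uncorrelated, with positive definite covariances, with
`x_k = G_{k,k-1} x_{k-1} + G_{k,N} x_N + e_k` for `k ∈ [1,N-1]`, and boundary
condition `x_N = e_N`, `x_0 = G_{0,N} x_N + e_0`. -/
def CMLModel (N d : ℕ) (μ : Measure Ω) (x : ℕ → Ω → Fin d → ℝ)
    (Gm GN Gcov : ℕ → Mat d) : Prop :=
  ∃ e : ℕ → Ω → Fin d → ℝ,
    ZMNG N d μ e (blockDiag N d Gcov) ∧
    (∀ k, k ≤ N → (Gcov k).PosDef) ∧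
    (∀ᵐ ω ∂μ,
      (∀ k, 1 ≤ k → k ≤ N - 1 →
        x k ω = (Gm k).mulVec (x (k - 1) ω) + (GN k).mulVec (x N ω) + e k ω) ∧
      x N ω = e N ω ∧ x 0 ω = (GN 0).mulVec (x N ω) + e 0 ω)

/-- `[y_k]` obeys the Markov model with parameters `Mm k = M_{k,k-1}` for
`k ∈ [1,N]` and noise covariances `Mcov k = M_k = Cov(e_k)`: the `e_k` are
zero-mean jointly Gaussian, mutually uncorrelated, with positive definite
covariances, `y_0 = e_0` and `y_k = M_{k,k-1} y_{k-1} + e_k` for `k ∈ [1,N]`. -/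
def MarkovModel (N d : ℕ) (μ : Measure Ω) (y : ℕ → Ω → Fin d → ℝ)
    (Mm Mcov : ℕ → Mat d) : Prop :=
  ∃ e : ℕ → Ω → Fin d → ℝ,
    ZMNG N d μ e (blockDiag N d Mcov) ∧
    (∀ k, k ≤ N → (Mcov k).PosDef) ∧
    (∀ᵐ ω ∂μ, y 0 ω = e 0 ω ∧
      ∀ k, 1 ≤ k → k ≤ N → y k ω = (Mm k).mulVec (y (k - 1) ω) + e k ω)

/-- Representation of `[x_k]` as a zero-mean nonsingular Gaussian Markov sequence
plus `Γ_k x_c`, where `c ∈ {0,N}`: `y` (which coincides with `x` at time `c`) is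
jointly zero-mean nonsingular Gaussian, the states of `y` at times `≠ c` are
uncorrelated with `y c = x c`, `y` is Markov on `[0,N] \ {c}`, and
`x_k = y_k + Γ_k x_c` for `k ∈ [0,N] \ {c}`. -/
def MarkovPlusVector (N d c : ℕ) (μ : Measure Ω) (x y : ℕ → Ω → Fin d → ℝ)
    (Γ : ℕ → Mat d) : Prop :=
  ∃ C' : Matrix (Fin (N + 1) × Fin d) (Fin (N + 1) × Fin d) ℝ,
    (∀ᵐ ω ∂μ, y c ω = x c ω) ∧
    ZMNG N d μ y C' ∧
    (∀ i j : Fin (N + 1),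
      (((i : ℕ) = c ∧ (j : ℕ) ≠ c) ∨ ((i : ℕ) ≠ c ∧ (j : ℕ) = c)) →
      ∀ a b, C' (i, a) (j, b) = 0) ∧
    IsMarkovOn μ y (if c = 0 then 1 else 0) (if c = 0 then N else N - 1) ∧
    (∀ᵐ ω ∂μ, ∀ k, k ≤ N → k ≠ c → x k ω = y k ω + (Γ k).mulVec (x c ω))

/-- `M_{N|k} = M_{N,N-1} ⋯ M_{k+1,k}` (with `M_{N|N} = I`), where `Mm k = M_{k,k-1}`. -/
def MNk (d : ℕ) (Mm : ℕ → Mat d) (N k : ℕ) : Mat d :=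
  (List.range (N - k)).foldl (fun A i => A * Mm (N - i)) 1

/-- `C_{N|k} = ∑_{n=k}^{N-1} M_{N|n+1} M_{n+1} M_{N|n+1}'`. -/
def CNk (d : ℕ) (Mm Mcov : ℕ → Mat d) (N k : ℕ) : Mat d :=
  ∑ n ∈ Finset.Icc k (N - 1), MNk d Mm N (n + 1) * Mcov (n + 1) * (MNk d Mm N (n + 1))ᵀ

/-- The `(N+1)d × (N+1)d` matrix `[[B₁, 0], [0, 0]]` (`B₁` occupies the first `N`
block rows and columns). -/
def embedL (N d : ℕ) (B₁ : Matrix (Fin N × Fin d) (Fin N × Fin d) ℝ) :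
    Matrix (Fin (N + 1) × Fin d) (Fin (N + 1) × Fin d) ℝ :=
  fun p q =>
    if h : (p.1 : ℕ) < N ∧ (q.1 : ℕ) < N then
      B₁ (⟨(p.1 : ℕ), h.1⟩, p.2) (⟨(q.1 : ℕ), h.2⟩, q.2)
    else 0

/-- The `(N+1)d × d` matrix `Γ = [S; I]`. -/
def gammaL (N d : ℕ) (S : Matrix (Fin N × Fin d) (Fin d) ℝ) :
    Matrix (Fin (N + 1) × Fin d) (Fin d) ℝ :=
  fun p a =>
    if h : (p.1 : ℕ) < N then S (⟨(p.1 : ℕ), h⟩, p.2) a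
    else (1 : Mat d) p.2 a

/-- The `(N+1)d × (N+1)d` matrix `[[0, 0], [0, B₂]]` (`B₂` occupies the last `N`
block rows and columns). -/
def embedF (N d : ℕ) (B₂ : Matrix (Fin N × Fin d) (Fin N × Fin d) ℝ) :
    Matrix (Fin (N + 1) × Fin d) (Fin (N + 1) × Fin d) ℝ :=
  fun p q =>
    if h : 0 < (p.1 : ℕ) ∧ 0 < (q.1 : ℕ) then
      B₂ (⟨(p.1 : ℕ) - 1, by have := p.1.isLt; omega⟩, p.2)
        (⟨(q.1 : ℕ) - 1, by have := q.1.isLt; omega⟩, q.2)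
    else 0

/-- The `(N+1)d × d` matrix `Γ = [I; S]`. -/
def gammaF (N d : ℕ) (S : Matrix (Fin N × Fin d) (Fin d) ℝ) :
    Matrix (Fin (N + 1) × Fin d) (Fin d) ℝ :=
  fun p a =>
    if h : 0 < (p.1 : ℕ) then
      S (⟨(p.1 : ℕ) - 1, by have := p.1.isLt; omega⟩, p.2) a
    else (1 : Mat d) p.2 a
theorem freeze {β γ : Type*} [MeasurableSpace β] [MeasurableSpace γ]
    (μ : Measure Ω) [IsProbabilityMeasure μ] (Y : Ω → β) (R : Ω → γ)
    (hY : Measurable Y) (hR : Measurable R) (hind : IndepFun Y R μ)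
    (h : β × γ → ℝ) (hh : Measurable h) (hb : ∀ z, ‖h z‖ ≤ 1) :
    μ[fun ω => h (Y ω, R ω) | MeasurableSpace.comap Y inferInstance]
      =ᵐ[μ] fun ω => ∫ r, h (Y ω, r) ∂(μ.map R) := by
  have : IsProbabilityMeasure (μ.map R) := Measure.isProbabilityMeasure_map hR.aemeasurable
  have : IsProbabilityMeasure (μ.map Y) := Measure.isProbabilityMeasure_map hY.aemeasurable
  have hg : StronglyMeasurable (fun y => ∫ r, h (y, r) ∂(μ.map R)) :=
    StronglyMeasurable.integral_prod_right (f := fun y r => h (y, r)) hh.stronglyMeasurable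
  have hgb : ∀ y, ‖∫ r, h (y, r) ∂(μ.map R)‖ ≤ 1 := by
    intro y
    have := norm_integral_le_of_norm_le_const (μ := μ.map R) (f := fun r => h (y, r)) (C := 1)
      (Filter.Eventually.of_forall fun r => hb _)
    simpa using this
  have hint : Integrable h ((μ.map Y).prod (μ.map R)) :=
    Integrable.of_bound hh.aestronglyMeasurable 1 (Filter.Eventually.of_forall hb)
  have hmap := (indepFun_iff_map_prod_eq_prod_map_map hY.aemeasurable hR.aemeasurable).1 hind
  symm
  refine ae_eq_condExp_of_forall_setIntegral_eq hY.comap_le ?_ ?_ ?_ ?_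
  · exact Integrable.of_bound (hh.comp (hY.prodMk hR)).aestronglyMeasurable 1
      (Filter.Eventually.of_forall fun _ => hb _)
  · intro s _ _
    exact (Integrable.of_bound (hg.measurable.comp hY).aestronglyMeasurable 1
      (Filter.Eventually.of_forall fun _ => hgb _)).integrableOn
  · rintro s ⟨B, hB, rfl⟩ _
    have e1 : ∫ ω in Y ⁻¹' B, h (Y ω, R ω) ∂μ
        = ∫ z in B ×ˢ Set.univ, h z ∂((μ.map Y).prod (μ.map R)) := by
      rw [← hmap, setIntegral_map (hB.prod MeasurableSet.univ) hh.aestronglyMeasurable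
        (hY.prodMk hR).aemeasurable]
      congr 2
      ext; simp
    have e2 : ∫ ω in Y ⁻¹' B, (∫ r, h (Y ω, r) ∂(μ.map R)) ∂μ
        = ∫ y in B, (∫ r, h (y, r) ∂(μ.map R)) ∂(μ.map Y) := by
      rw [setIntegral_map hB hg.aestronglyMeasurable hY.aemeasurable]
    rw [e1, e2, setIntegral_prod _ hint.integrableOn]
    simp
  · exact (hg.comp_measurable (comap_measurable Y)).aestronglyMeasurable

theorem gaussLaw {ι : Type*} [Fintype ι] (μ : Measure Ω) [IsProbabilityMeasure μ]
    (X : Ω → ι → ℝ) (hX : Measurable X) (C : Matrix ι ι ℝ)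
    (h : IsZeroMeanGaussian μ X C) : HasGaussianLaw X μ := by
  classical
  refine ⟨⟨fun L => ?_⟩⟩
  have key : μ.map (fun ω => L (X ω)) =
      gaussianReal 0 ((fun i => L (Pi.single i 1)) ⬝ᵥ C.mulVec (fun i => L (Pi.single i 1))).toNNReal := by
    rw [← h]
    congr 1
    ext ω
    conv_lhs => rw [← LinearMap.sum_single_apply (φ := fun _ => ℝ) (v := X ω)]
    rw [map_sum]
    refine Finset.sum_congr rfl fun i _ => ?_
    have : (Pi.single i (X ω i) : ι → ℝ) = X ω i • Pi.single i 1 := by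
      rw [← Pi.single_smul]; simp
    change L (Pi.single i (X ω i)) = _
    rw [this, map_smul, smul_eq_mul, mul_comm]
  have e : (μ.map X).map L = μ.map (fun ω => L (X ω)) :=
    Measure.map_map L.measurable hX
  have hi : ∫ x, L x ∂(μ.map X) = ∫ z, z ∂((μ.map X).map L) := by
    rw [integral_map (φ := L) (by fun_prop) (by fun_prop)]
  have hv : Var[L; μ.map X] = Var[id; (μ.map X).map L] := by
    rw [variance_map (Y := L) (by fun_prop) (by fun_prop)]; rfl
  rw [hi, hv, e, key, integral_id_gaussianReal, variance_id_gaussianReal, Real.toNNReal_coe]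

theorem gaussVar {ι : Type*} [Fintype ι] (μ : Measure Ω) [IsProbabilityMeasure μ]
    (X : Ω → ι → ℝ) (hX : Measurable X) (C : Matrix ι ι ℝ) (hC : C.PosDef)
    (h : IsZeroMeanGaussian μ X C) (l : ι → ℝ) :
    Var[fun ω => ∑ i, l i * X ω i; μ] = l ⬝ᵥ C.mulVec l := by
  have hm : Measurable (fun ω => ∑ i, l i * X ω i) := by fun_prop
  have hv : Var[id; μ.map (fun ω => ∑ i, l i * X ω i)] = Var[fun ω => ∑ i, l i * X ω i; μ] := by
    rw [variance_map (by fun_prop) (by fun_prop)]; rfl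
  rw [← hv, h l, variance_id_gaussianReal]
  refine Real.coe_toNNReal _ ?_
  simpa using hC.posSemidef.dotProduct_mulVec_nonneg l

theorem gaussCov {ι : Type*} [Fintype ι] (μ : Measure Ω) [IsProbabilityMeasure μ]
    (X : Ω → ι → ℝ) (hX : Measurable X) (C : Matrix ι ι ℝ) (hC : C.PosDef)
    (h : IsZeroMeanGaussian μ X C) (p q : ι) :
    cov[fun ω => X ω p, fun ω => X ω q; μ] = C p q := by
  classical
  have hL := gaussLaw μ X hX C h
  have hm : ∀ p, MemLp (fun ω => X ω p) 2 μ := fun p =>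
    (HasGaussianLaw.eval (X := fun i ω => X ω i) hL p).memLp_two
  have h1 : ∀ p, Var[fun ω => X ω p; μ] = C p p := by
    intro p
    have := gaussVar μ X hX C hC h (Pi.single p 1)
    simpa [Pi.single_apply] using this
  have h2 : Var[fun ω => X ω p + X ω q; μ] = C p p + C p q + C q p + C q q := by
    have := gaussVar μ X hX C hC h (Pi.single p 1 + Pi.single q 1)
    simp [Pi.single_apply, add_mul, Finset.sum_add_distrib, Matrix.mulVec_add] at this
    rw [this]; ring
  have h3 : Var[fun ω => X ω p + X ω q; μ] = _ := variance_fun_add (hm p) (hm q)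
  have h4 : C q p = C p q := by
    have := hC.isHermitian.apply p q
    simpa using this
  rw [h1, h1] at h3
  linarith

theorem exists_M {N d : ℕ} (C : Matrix (Fin (N + 1) × Fin d) (Fin (N + 1) × Fin d) ℝ)
    (hC : C.PosDef) (hT : BlockTriDiag C⁻¹) (j k : Fin (N + 1)) (hjk : j < k) :
    ∃ M : Mat d, ∀ i, i ≤ j → ∀ a c, C (k, a) (i, c) = ∑ b, M a b * C (j, b) (i, c) := by
  have hPp : (C⁻¹).PosDef := hC.inv
  have hPC : C⁻¹ * C = 1 :=
    Matrix.nonsing_inv_mul _ ((Matrix.isUnit_iff_isUnit_det _).1 hC.isUnit)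
  generalize C⁻¹ = P at *
  let F := {p : Fin (N + 1) × Fin d // j < p.1}
  let S : Matrix F F ℝ := P.submatrix Subtype.val Subtype.val
  have hS : S.PosDef := hPp.submatrix Subtype.val_injective
  have hWS : S⁻¹ * S = 1 :=
    Matrix.nonsing_inv_mul _ ((Matrix.isUnit_iff_isUnit_det _).1 hS.isUnit)
  generalize S⁻¹ = W at hWS
  refine ⟨fun a b => -∑ p : F, W ⟨(k, a), hjk⟩ p * P p.1 (j, b), fun i hi a c => ?_⟩
  -- the row equation
  have row : ∀ p : F, ∑ q : F, S p q * C q.1 (i, c) = -∑ b, P p.1 (j, b) * C (j, b) (i, c) := by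
    intro p
    have h0 : (P * C) p.1 (i, c) = 0 := by
      rw [hPC, Matrix.one_apply_ne]
      intro h
      have := p.2
      rw [h] at this
      exact absurd this (not_lt.2 hi)
    rw [Matrix.mul_apply, ← Fintype.sum_subtype_add_sum_subtype (fun q => j < q.1)] at h0
    have h1 : ∑ q : {q : Fin (N + 1) × Fin d // ¬ j < q.1}, P p.1 q.1 * C q.1 (i, c)
        = ∑ b, P p.1 (j, b) * C (j, b) (i, c) := by
      rw [← Finset.sum_subtype (Finset.univ.filter fun q : Fin (N + 1) × Fin d => ¬ j < q.1)
        (by simp) (fun q => P p.1 q * C q (i, c)), Finset.sum_filter, Fintype.sum_prod_type,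
        Finset.sum_eq_single j]
      · simp
      · intro m _ hm
        refine Finset.sum_eq_zero fun b _ => ?_
        split_ifs with h
        · rfl
        · have : P p.1 (m, b) = 0 := by
            refine hT p.1.1 m ?_ p.1.2 b
            right
            have h2 := p.2
            replace h : m ≤ j := not_lt.1 h
            have h3 : m < j := lt_of_le_of_ne h hm
            have h4 : (m : ℕ) < j := h3
            have h5 : (j : ℕ) < p.1.1 := h2
            omega
          rw [this, zero_mul]
      · simp
    rw [h1] at h0
    exact eq_neg_of_add_eq_zero_left h0
  have e : C (k, a) (i, c) = ∑ p : F, W ⟨(k, a), hjk⟩ p * ∑ q : F, S p q * C q.1 (i, c) := by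
    have : ((W * S) *ᵥ (fun q : F => C q.1 (i, c))) ⟨(k, a), hjk⟩ = C (k, a) (i, c) := by
      rw [hWS]; simp
    rw [← this, ← Matrix.mulVec_mulVec]
    rfl
  rw [e]
  simp_rw [row, neg_mul, Finset.sum_mul, mul_neg, Finset.mul_sum]
  rw [Finset.sum_neg_distrib, Finset.sum_neg_distrib, Finset.sum_comm]
  simp_rw [mul_assoc]

/-- Entries of the block matrix `L` with `L x = e`. -/
def Lf (N d : ℕ) (Gm GN : ℕ → Mat d) (k j : ℕ) : Mat d :=
  (if k = j then 1 else 0) - (if j = N then (if k < N then GN k else 0) else 0)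
    - (if j + 1 = k then (if k < N then Gm k else 0) else 0)

def Lb (N d : ℕ) (Gm GN : ℕ → Mat d) : Matrix (Fin (N + 1)) (Fin (N + 1)) (Mat d) :=
  fun k j => Lf N d Gm GN k j

theorem comp_mul' {n d : ℕ} (A B : Matrix (Fin n) (Fin n) (Mat d)) :
    Matrix.comp _ _ _ _ ℝ (A * B) = Matrix.comp _ _ _ _ ℝ A * Matrix.comp _ _ _ _ ℝ B :=
  map_mul (Matrix.compRingEquiv (Fin n) (Fin d) ℝ) A B

theorem blockDiag_comp (N d : ℕ) (G : ℕ → Mat d) :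
    blockDiag N d G = Matrix.comp _ _ _ _ ℝ (Matrix.diagonal fun k : Fin (N + 1) => G k) := by
  ext ⟨i, a⟩ ⟨j, b⟩
  simp only [blockDiag, Matrix.comp_apply, Matrix.diagonal_apply, Fin.val_inj]
  split_ifs <;> simp

theorem Lx (N d : ℕ) (Gm GN : ℕ → Mat d) (y e : ℕ → Fin d → ℝ)
    (h1 : ∀ k, 1 ≤ k → k ≤ N - 1 →
        y k = (Gm k).mulVec (y (k - 1)) + (GN k).mulVec (y N) + e k)
    (h2 : y N = e N) (h3 : y 0 = (GN 0).mulVec (y N) + e 0) (hN : 3 ≤ N) :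
    (Matrix.comp _ _ _ _ ℝ (Lb N d Gm GN)) *ᵥ (fun p : Fin (N + 1) × Fin d => y p.1 p.2)
      = fun p => e p.1 p.2 := by
  ext ⟨k, a⟩
  have e0 : ((Matrix.comp _ _ _ _ ℝ (Lb N d Gm GN)) *ᵥ
      (fun p : Fin (N + 1) × Fin d => y p.1 p.2)) (k, a)
      = (∑ j : Fin (N + 1), Lf N d Gm GN k j *ᵥ y j) a := by
    simp only [Matrix.mulVec, dotProduct, Fintype.sum_prod_type, Finset.sum_apply,
      Matrix.comp_apply, Lb]
  rw [e0]
  have hk := k.2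
  generalize (k : ℕ) = k at *
  rw [Fin.sum_univ_eq_sum_range (fun j => Lf N d Gm GN k j *ᵥ y j) (N + 1)]
  change _ = e k a
  congr 1
  have e1 : ∀ j, Lf N d Gm GN k j *ᵥ y j =
      (if k = j then y j else 0) - (if j = N then (if k < N then GN k *ᵥ y j else 0) else 0)
      - (if j + 1 = k then (if k < N then Gm k *ᵥ y j else 0) else 0) := by
    intro j
    rw [Lf, Matrix.sub_mulVec, Matrix.sub_mulVec]
    congr 1
    · congr 1
      · split_ifs <;> simp
      · split_ifs <;> simp
    · split_ifs <;> simp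
  simp_rw [e1]
  rw [Finset.sum_sub_distrib, Finset.sum_sub_distrib, Finset.sum_ite_eq, Finset.sum_ite_eq']
  rw [if_pos (by simpa using hk), if_pos (by simp)]
  rcases Nat.eq_zero_or_pos k with rfl | hk0
  · simp only [Nat.add_eq_zero_iff, one_ne_zero, and_false, if_false, Finset.sum_const_zero]
    rw [if_pos (by omega), h3]; simp
  · obtain ⟨m, rfl⟩ : ∃ m, k = m + 1 := ⟨k - 1, by omega⟩
    simp only [add_left_inj]
    rw [Finset.sum_ite_eq', if_pos (Finset.mem_range.2 (by omega : m < N + 1))]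
    by_cases hkN : m + 1 < N
    · rw [if_pos hkN, if_pos hkN, h1 (m + 1) (by omega) (by omega)]
      simp only [Nat.add_sub_cancel, Pi.sub_apply, Pi.add_apply]
      ring
    · have : m + 1 = N := by omega
      rw [if_neg hkN, if_neg hkN, this, h2]; simp

theorem Pb_zero (N d : ℕ) (hN : 3 ≤ N) (Gm GN Gcov : ℕ → Mat d)
    (hrec : ∀ k, k ≤ N - 2 →
      (Gcov k)⁻¹ * GN k = (Gm (k + 1))ᵀ * (Gcov (k + 1))⁻¹ * GN (k + 1))
    (i j : Fin (N + 1)) (hij : (i : ℕ) + 2 ≤ j) :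
    ((Lb N d Gm GN)ᵀ.map (·ᵀ) * (Matrix.diagonal fun k : Fin (N + 1) => (Gcov k)⁻¹)
      * Lb N d Gm GN) i j = 0 := by
  rw [Matrix.mul_apply]
  simp only [Matrix.mul_diagonal, Matrix.map_apply, Matrix.transpose_apply, Lb]
  obtain ⟨j, hj⟩ := j
  obtain ⟨i, hi⟩ := i
  dsimp only at hij ⊢
  rw [Fin.sum_univ_eq_sum_range
    (fun k => (Lf N d Gm GN k i)ᵀ * (Gcov k)⁻¹ * Lf N d Gm GN k j) (N + 1)]
  have hiN : i ≠ N := by omega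
  by_cases hjN : j = N
  · subst hjN
    have : ∀ k, (Lf j d Gm GN k i)ᵀ * (Gcov k)⁻¹ * Lf j d Gm GN k j =
        (if k = i then -((Gcov i)⁻¹ * GN i) else 0) +
        (if k = i + 1 then (Gm (i + 1))ᵀ * (Gcov (i + 1))⁻¹ * GN (i + 1) else 0) := by
      intro k
      by_cases h1 : k = i
      · subst h1
        simp [Lf, show k ≠ j by omega, show k < j by omega, show j + 1 ≠ k by omega]
      · by_cases h2 : k = i + 1
        · subst h2
          simp [Lf, show i + 1 ≠ j by omega, show i + 1 < j by omega, show j ≠ i by omega, hiN]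
        · simp [Lf, h1, h2, show i + 1 ≠ k by omega, hiN]
    simp_rw [this]
    rw [Finset.sum_add_distrib, Finset.sum_ite_eq', Finset.sum_ite_eq',
      if_pos (Finset.mem_range.2 hi), if_pos (Finset.mem_range.2 (by omega : i + 1 < j + 1)), hrec i (by omega)]
    simp
  · refine Finset.sum_eq_zero fun k _ => ?_
    by_cases h1 : k = i
    · simp [Lf, hjN, show k ≠ j by omega, show j + 1 ≠ k by omega]
    · by_cases h2 : k = i + 1
      · simp [Lf, hjN, show k ≠ j by omega, show j + 1 ≠ k by omega]
      · simp [Lf, hiN, h1, show i + 1 ≠ k by omega]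

theorem quad_ext {ι : Type*} [Fintype ι] (A B : Matrix ι ι ℝ)
    (hA : A.IsHermitian) (hB : B.IsHermitian)
    (h : ∀ l : ι → ℝ, l ⬝ᵥ A *ᵥ l = l ⬝ᵥ B *ᵥ l) : A = B := by
  classical
  ext p q
  have h1 := h (Pi.single p 1)
  have h2 := h (Pi.single q 1)
  have h3 := h (Pi.single p 1 + Pi.single q 1)
  have hA' : A q p = A p q := by simpa using hA.apply p q
  have hB' : B q p = B p q := by simpa using hB.apply p q
  simp [Matrix.mulVec_add] at h1 h2 h3
  linarith

theorem measurable_stack {N d : ℕ} {x : ℕ → Ω → Fin d → ℝ}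
    (h : ∀ k, k ≤ N → Measurable (x k)) : Measurable (stack N d x) := by
  refine measurable_pi_lambda _ fun p => ?_
  exact (measurable_pi_apply p.2).comp (h p.1 (by have := p.1.2; omega))

theorem tri {N d : ℕ} (hN : 3 ≤ N)
    (μ : Measure Ω) [IsProbabilityMeasure μ] (x : ℕ → Ω → Fin d → ℝ)
    (C : Matrix (Fin (N + 1) × Fin d) (Fin (N + 1) × Fin d) ℝ)
    (hx : ZMNG N d μ x C) (Gm GN Gcov : ℕ → Mat d)
    (hmodel : CMLModel N d μ x Gm GN Gcov)
    (hrec : ∀ k, 1 ≤ k → k ≤ N - 2 →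
      (Gcov k)⁻¹ * GN k = (Gm (k + 1))ᵀ * (Gcov (k + 1))⁻¹ * GN (k + 1))
    (hbc : GN 0 = Gcov 0 * (Gm 1)ᵀ * (Gcov 1)⁻¹ * GN 1) :
    BlockTriDiag C⁻¹ := by
  obtain ⟨hxm, hxg, hC⟩ := hx
  obtain ⟨e, ⟨hem, heg, hG⟩, hpos, hae⟩ := hmodel
  have hdet : ∀ k, k ≤ N → IsUnit (Gcov k).det := fun k hk =>
    (Matrix.isUnit_iff_isUnit_det _).1 (hpos k hk).isUnit
  have hrec' : ∀ k, k ≤ N - 2 →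
      (Gcov k)⁻¹ * GN k = (Gm (k + 1))ᵀ * (Gcov (k + 1))⁻¹ * GN (k + 1) := by
    intro k hk
    rcases Nat.eq_zero_or_pos k with rfl | h
    · rw [hbc]
      simp only [zero_add, Matrix.mul_assoc]
      rw [Matrix.nonsing_inv_mul_cancel_left _ _ (hdet 0 (by omega))]
    · exact hrec k h hk
  set L := Matrix.comp _ _ _ _ ℝ (Lb N d Gm GN) with hL
  have hLX : ∀ᵐ ω ∂μ, L *ᵥ stack N d x ω = stack N d e ω := by
    filter_upwards [hae] with ω hω
    exact Lx N d Gm GN (fun k => x k ω) (fun k => e k ω) hω.1 hω.2.1 hω.2.2 hN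
  have hq : L * C * Lᵀ = blockDiag N d Gcov := by
    refine quad_ext _ _ ?_ hG.isHermitian ?_
    · have := Matrix.isHermitian_mul_mul_conjTranspose L hC.isHermitian
      simpa using this
    · intro l
      rw [← gaussVar μ _ (measurable_stack hem) _ hG heg l]
      have : (fun ω => ∑ i, l i * stack N d e ω i) =ᵐ[μ]
          fun ω => ∑ i, (Lᵀ *ᵥ l) i * stack N d x ω i := by
        filter_upwards [hLX] with ω hω
        change l ⬝ᵥ stack N d e ω = (Lᵀ *ᵥ l) ⬝ᵥ stack N d x ω
        rw [← hω, Matrix.dotProduct_mulVec, Matrix.mulVec_transpose]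
      rw [variance_congr this, gaussVar μ _ (measurable_stack hxm) _ hC hxg]
      rw [← Matrix.mulVec_mulVec, ← Matrix.mulVec_mulVec, Matrix.dotProduct_mulVec,
        ← Matrix.mulVec_transpose]
  have hGi : blockDiag N d Gcov * blockDiag N d (fun k => (Gcov k)⁻¹) = 1 := by
    rw [blockDiag_comp, blockDiag_comp, ← comp_mul', Matrix.diagonal_mul_diagonal,
      ← Matrix.comp_one, ← Matrix.diagonal_one]
    congr 2
    ext1 k
    exact Matrix.mul_nonsing_inv _ (hdet k (by have := k.2; omega))
  have hinv : C⁻¹ = Lᵀ * blockDiag N d (fun k => (Gcov k)⁻¹) * L := by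
    refine Matrix.inv_eq_right_inv ?_
    rw [← hq] at hGi
    rw [Matrix.mul_assoc, Matrix.mul_assoc] at hGi
    have := mul_eq_one_comm.1 hGi
    simpa only [Matrix.mul_assoc] using this
  have hsymm : (C⁻¹).IsHermitian := hC.inv.isHermitian
  have half : ∀ i j : Fin (N + 1), (i : ℕ) + 2 ≤ j → BlockZero C⁻¹ i j := by
    intro i j hij a b
    have := Pb_zero N d hN Gm GN Gcov hrec' i j hij
    have h2 : C⁻¹ = Matrix.comp _ _ _ _ ℝ ((Lb N d Gm GN)ᵀ.map (·ᵀ) *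
        (Matrix.diagonal fun k : Fin (N + 1) => (Gcov k)⁻¹) * Lb N d Gm GN) := by
      rw [hinv, comp_mul', comp_mul', blockDiag_comp, hL, Matrix.transpose_comp]
    rw [h2, Matrix.comp_apply, this]; rfl
  rintro i j (h | h)
  · exact half i j h
  · intro a b
    have := hsymm.apply (i, a) (j, b)
    rw [← this, half j i h b a]; simp

theorem sigmaOf_Icc {d : ℕ} (x : ℕ → Ω → Fin d → ℝ) (j : ℕ) :
    sigmaOf x (Set.Icc 0 j) = MeasurableSpace.comap
      (fun ω (p : Fin (j + 1) × Fin d) => x p.1 ω p.2) inferInstance := by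
  apply le_antisymm
  · refine iSup₂_le fun i hi => ?_
    have : x i = (fun (v : Fin (j + 1) × Fin d → ℝ) a => v (⟨i, Nat.lt_succ_of_le hi.2⟩, a)) ∘
        (fun ω (p : Fin (j + 1) × Fin d) => x p.1 ω p.2) := rfl
    rw [this, ← MeasurableSpace.comap_comp]
    refine MeasurableSpace.comap_mono (Measurable.comap_le ?_)
    fun_prop
  · change MeasurableSpace.comap _ MeasurableSpace.pi ≤ _
    rw [MeasurableSpace.pi, MeasurableSpace.comap_iSup]
    refine iSup_le fun p => ?_
    rw [MeasurableSpace.comap_comp]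
    have : ((fun v : Fin (j + 1) × Fin d → ℝ => v p) ∘
        fun ω (p : Fin (j + 1) × Fin d) => x p.1 ω p.2)
        = (fun v : Fin d → ℝ => v p.2) ∘ x p.1 := rfl
    rw [this, ← MeasurableSpace.comap_comp]
    refine le_trans (MeasurableSpace.comap_mono (measurable_pi_apply p.2).comap_le) ?_
    exact le_iSup₂_of_le (f := fun i (_ : i ∈ Set.Icc 0 j) =>
      MeasurableSpace.comap (x i) inferInstance) (p.1 : ℕ)
      ⟨Nat.zero_le _, Nat.le_of_lt_succ p.1.2⟩ le_rfl

theorem sigmaOf_single {d : ℕ} (x : ℕ → Ω → Fin d → ℝ) (j : ℕ) :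
    sigmaOf x {j} = MeasurableSpace.comap (x j) inferInstance := by
  simp [sigmaOf]

theorem markov_of_tri {N d : ℕ}
    (μ : Measure Ω) [IsProbabilityMeasure μ] (x : ℕ → Ω → Fin d → ℝ)
    (C : Matrix (Fin (N + 1) × Fin d) (Fin (N + 1) × Fin d) ℝ)
    (hx : ZMNG N d μ x C) (hT : BlockTriDiag C⁻¹) : IsMarkovOn μ x 0 N := by
  obtain ⟨hxm, hxg, hC⟩ := hx
  intro j k _ hjk hkN A hA
  have hjN : j < N + 1 := by omega
  have hkN' : k < N + 1 := by omega
  obtain ⟨M, hM⟩ := exists_M C hC hT ⟨j, hjN⟩ ⟨k, hkN'⟩ hjk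
  let R : Ω → Fin d → ℝ := fun ω a => x k ω a - ∑ b, M a b * x j ω b
  let Y : Ω → Fin (j + 1) × Fin d → ℝ := fun ω p => x p.1 ω p.2
  have hxj : Measurable (x j) := hxm j (by omega)
  have hxk : Measurable (x k) := hxm k hkN
  have hR : Measurable R := by
    refine measurable_pi_lambda _ fun a => ?_
    fun_prop
  have hY : Measurable Y := by
    refine measurable_pi_lambda _ fun p => ?_
    exact (measurable_pi_apply p.2).comp (hxm p.1 (by have := p.1.2; omega))
  have hlaw := gaussLaw μ _ (measurable_stack hxm) C hxg
  have hcov := gaussCov μ _ (measurable_stack hxm) C hC hxg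
  have hmem : ∀ p, MemLp (fun ω => stack N d x ω p) 2 μ := fun p =>
    (HasGaussianLaw.eval (X := fun i ω => stack N d x ω i) hlaw p).memLp_two
  have hind : IndepFun Y R μ := by
    let T : (Fin (N + 1) × Fin d → ℝ) →L[ℝ] (Fin (j + 1) × Fin d → ℝ) × (Fin d → ℝ) :=
      LinearMap.toContinuousLinearMap
        { toFun := fun v => (fun p => v (Fin.castLE (by omega) p.1, p.2),
            fun a => v (⟨k, hkN'⟩, a) - ∑ b, M a b * v (⟨j, hjN⟩, b))
          map_add' := by
            intro v w
            ext a
            · rfl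
            · simp [mul_add, Finset.sum_add_distrib]; ring
          map_smul' := by
            intro c v
            ext a
            · rfl
            · simp only [Pi.smul_apply, smul_eq_mul, RingHom.id_apply, Prod.smul_snd, mul_sub,
                Finset.mul_sum]
              congr 1
              exact Finset.sum_congr rfl fun b _ => by ring }
    have hYR : HasGaussianLaw (fun ω => (Y ω, R ω)) μ := hlaw.map T
    refine HasGaussianLaw.indepFun_of_covariance_eval (X := fun p ω => Y ω p)
      (Y := fun a ω => R ω a) hYR ?_
    intro p a
    rw [covariance_comm]
    have h1 := hmem (⟨k, hkN'⟩, a)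
    have h2 : ∀ b, MemLp (fun ω => stack N d x ω (⟨j, hjN⟩, b)) 2 μ := fun b => hmem _
    have h3 := hmem (Fin.castLE (by omega) p.1, p.2)
    have e : cov[fun ω => stack N d x ω (⟨k, hkN'⟩, a) -
        ∑ b, M a b * stack N d x ω (⟨j, hjN⟩, b),
        fun ω => stack N d x ω (Fin.castLE (by omega) p.1, p.2); μ] = 0 := by
      rw [covariance_fun_sub_left h1 (memLp_finsetSum _ fun b _ => (h2 b).const_mul _) h3,
        covariance_fun_sum_left (fun b => (h2 b).const_mul _) h3]
      simp_rw [covariance_const_mul_left, hcov]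
      rw [hM _ (by
        change (p.1 : ℕ) ≤ j
        have := p.1.2
        omega), sub_self]
    exact e
  have hind' : IndepFun (x j) R μ :=
    hind.comp (φ := fun (v : Fin (j + 1) × Fin d → ℝ) a => v (⟨j, Nat.lt_succ_self j⟩, a))
      (ψ := id) (by fun_prop) measurable_id
  have hxk_eq : ∀ ω, x k ω = M *ᵥ x j ω + R ω := by
    intro ω
    ext a
    simp [R, Matrix.mulVec, dotProduct]
  have hind1 : Measurable (A.indicator (fun _ => (1 : ℝ))) := measurable_const.indicator hA
  have hb1 : ∀ z, ‖A.indicator (fun _ => (1 : ℝ)) z‖ ≤ 1 := by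
    intro z
    by_cases h : z ∈ A <;> simp [h]
  have hMm : Measurable (fun v : Fin d → ℝ => M *ᵥ v) :=
    (Continuous.matrix_mulVec continuous_const continuous_id).measurable
  have f1 := freeze μ Y R hY hR hind
    (fun z => A.indicator (fun _ => (1 : ℝ))
      (M *ᵥ (fun a => z.1 (⟨j, Nat.lt_succ_self j⟩, a)) + z.2))
    (hind1.comp ((hMm.comp (by fun_prop)).add measurable_snd)) (fun _ => hb1 _)
  have f2 := freeze μ (x j) R hxj hR hind'
    (fun z => A.indicator (fun _ => (1 : ℝ)) (M *ᵥ z.1 + z.2))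
    (hind1.comp ((hMm.comp measurable_fst).add measurable_snd)) (fun _ => hb1 _)
  have e : A.indicator (fun _ => (1 : ℝ)) ∘ x k =
      fun ω => A.indicator (fun _ => (1 : ℝ)) (M *ᵥ x j ω + R ω) := by
    ext ω
    simp only [Function.comp, hxk_eq ω]
  rw [sigmaOf_Icc, sigmaOf_single, e]
  exact f1.trans f2.symm

/-- If a zero-mean nonsingular Gaussian sequence `[x_k]` obeys a
CM_L model whose parameters satisfy the reciprocity condition
`G_k⁻¹ G_{k,N} = G_{k+1,k}' G_{k+1}⁻¹ G_{k+1,N}` for all `k ∈ [1,N-2]`, and the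
boundary parameter satisfies `G_{0,N} = G_0 G_{1,0}' G_1⁻¹ G_{1,N}`, then `[x_k]`
is Markov. (In particular, the set of reciprocal sequences modeled by a given
reciprocal CM_L model contains Markov sequences.) -/
theorem stmt9 {N d : ℕ} (hN : 3 ≤ N) (hd : 1 ≤ d)
    (μ : Measure Ω) [IsProbabilityMeasure μ] (x : ℕ → Ω → Fin d → ℝ)
    (C : Matrix (Fin (N + 1) × Fin d) (Fin (N + 1) × Fin d) ℝ)
    (hx : ZMNG N d μ x C) (Gm GN Gcov : ℕ → Mat d)
    (hmodel : CMLModel N d μ x Gm GN Gcov)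
    (hrec : ∀ k, 1 ≤ k → k ≤ N - 2 →
      (Gcov k)⁻¹ * GN k = (Gm (k + 1))ᵀ * (Gcov (k + 1))⁻¹ * GN (k + 1))
    (hbc : GN 0 = Gcov 0 * (Gm 1)ᵀ * (Gcov 1)⁻¹ * GN 1) :
    IsMarkovOn μ x 0 N := by
  exact markov_of_tri μ x C hx (tri hN μ x C hx Gm GN Gcov hmodel hrec hbc)

end CMSeqPaper
end

section
/- (Markov-induced CM_L model) A zero-mean nonsingular Gaussian sequence [x_k], k ∈ [0,N], is reciprocal if and only if it obeys a CM_L model whose parameters (G_{k,k−1}, G_{k,N}, G_k), k ∈ [1,N−1], are given, for some d×d matrices M_{k,k−1}, k ∈ [1,N], and d×d positive definite matrices M_k, k ∈ [1,N], by: G_k = (M_k⁻¹ + M_{N|k}' C_{N|k}⁻¹ M_{N|k})⁻¹, G_{k,N} = G_k M_{N|k}' C_{N|k}⁻¹, and G_{k,k−1} = M_{k,k−1} − G_{k,N} M_{N|k} M_{k,k−1}, where M_{N|k} = M_{N,N−1} ⋯ M_{k+1,k}, M_{N|N} = I, and C_{N|k} = Σ_{n=k}^{N−1} M_{N|n+1}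 M_{n+1} M_{N|n+1}'. -/
open MeasureTheory ProbabilityTheory Matrix
open scoped NNReal

namespace CMSeqPaper

variable {Ω : Type*} [MeasurableSpace Ω]

section Prob

lemma zmg_hasGaussianLaw {ι : Type*} [Fintype ι] {μ : Measure Ω} {X : Ω → ι → ℝ}
    {C : Matrix ι ι ℝ} (hX : Measurable X) (h : IsZeroMeanGaussian μ X C) :
    HasGaussianLaw X μ := by
  classical
  refine ⟨isGaussian_of_map_eq_gaussianReal fun L => ?_⟩
  refine ⟨0, ((fun i => L (Pi.single i 1)) ⬝ᵥ C.mulVec (fun i => L (Pi.single i 1))).toNNReal, ?_⟩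
  · rw [Measure.map_map (by fun_prop) hX]
    rw [← h (fun i => L (Pi.single i 1))]
    congr 1
    ext ω
    simp only [Function.comp]
    conv_lhs => rw [pi_eq_sum_univ (X ω)]
    rw [map_sum]
    refine Finset.sum_congr rfl fun i _ => ?_
    rw [map_smul, smul_eq_mul, mul_comm]
    congr 2
    ext j
    simp [Pi.single_apply, eq_comm]

lemma zmg_memLp {ι : Type*} [Fintype ι] {μ : Measure Ω} {X : Ω → ι → ℝ}
    {C : Matrix ι ι ℝ} (hX : Measurable X) (h : IsZeroMeanGaussian μ X C) (l : ι → ℝ) :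
    MemLp (fun ω => ∑ i, l i * X ω i) 2 μ := by
  have hm : Measurable (fun ω => ∑ i, l i * X ω i) := by fun_prop
  have : MemLp id 2 (μ.map (fun ω => ∑ i, l i * X ω i)) := by
    rw [h l]; exact memLp_id_gaussianReal' 2 (by simp)
  exact (memLp_map_measure_iff (by fun_prop) hm.aemeasurable).1 this

lemma zmg_integral {ι : Type*} [Fintype ι] {μ : Measure Ω} {X : Ω → ι → ℝ}
    {C : Matrix ι ι ℝ} (hX : Measurable X) (h : IsZeroMeanGaussian μ X C) (l : ι → ℝ) :
    ∫ ω, (∑ i, l i * X ω i) ∂μ = 0 := by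
  have hm : Measurable (fun ω => ∑ i, l i * X ω i) := by fun_prop
  have : ∫ y, y ∂(μ.map (fun ω => ∑ i, l i * X ω i)) = 0 := by
    rw [h l]; exact integral_id_gaussianReal
  rwa [integral_map hm.aemeasurable (by fun_prop)] at this

lemma zmg_var {ι : Type*} [Fintype ι] {μ : Measure Ω} {X : Ω → ι → ℝ}
    {C : Matrix ι ι ℝ} (hX : Measurable X) (h : IsZeroMeanGaussian μ X C)
    (hC : C.PosDef) (l : ι → ℝ) :
    Var[fun ω => ∑ i, l i * X ω i; μ] = l ⬝ᵥ C.mulVec l := by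
  have hm : Measurable (fun ω => ∑ i, l i * X ω i) := by fun_prop
  have h1 : Var[id; μ.map (fun ω => ∑ i, l i * X ω i)] = (l ⬝ᵥ C.mulVec l).toNNReal := by
    rw [h l]; exact variance_id_gaussianReal
  rw [variance_id_map hm.aemeasurable] at h1
  rw [h1]
  exact Real.coe_toNNReal _ (by simpa using hC.posSemidef.dotProduct_mulVec_nonneg l)

lemma zmg_cov {ι : Type*} [Fintype ι] {μ : Measure Ω} [IsProbabilityMeasure μ] {X : Ω → ι → ℝ}
    {C : Matrix ι ι ℝ} (hX : Measurable X) (h : IsZeroMeanGaussian μ X C)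
    (hC : C.PosDef) (l m : ι → ℝ) :
    cov[fun ω => ∑ i, l i * X ω i, fun ω => ∑ i, m i * X ω i; μ] = l ⬝ᵥ C.mulVec m := by
  have h1 := zmg_var hX h hC (l + m)
  have e1 : (fun ω => ∑ i, (l + m) i * X ω i) =
    (fun ω => ∑ i, l i * X ω i) + (fun ω => ∑ i, m i * X ω i) := by
    ext ω; simp [add_mul, Finset.sum_add_distrib]
  rw [e1, variance_add (zmg_memLp hX h l) (zmg_memLp hX h m), zmg_var hX h hC,
    zmg_var hX h hC] at h1
  have hs : m ⬝ᵥ C.mulVec l = l ⬝ᵥ C.mulVec m := by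
    have := hC.isHermitian
    rw [Matrix.IsHermitian, Matrix.conjTranspose_eq_transpose_of_trivial] at this
    rw [Matrix.dotProduct_mulVec, ← Matrix.mulVec_transpose, this, dotProduct_comm]
  simp only [Matrix.mulVec_add, dotProduct_add, add_dotProduct] at h1
  linarith

lemma zmg_indep {ι κ lam : Type*} [Fintype ι] [Fintype κ] [Fintype lam]
    {μ : Measure Ω} [IsProbabilityMeasure μ] {X : Ω → ι → ℝ}
    {C : Matrix ι ι ℝ} (hX : Measurable X) (h : IsZeroMeanGaussian μ X C)
    (hC : C.PosDef) (A : Matrix κ ι ℝ) (B : Matrix lam ι ℝ)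
    (hAB : ∀ a b, A a ⬝ᵥ C.mulVec (B b) = 0) :
    IndepFun (fun ω => A.mulVec (X ω)) (fun ω => B.mulVec (X ω)) μ := by
  have hg := zmg_hasGaussianLaw hX h
  have := HasGaussianLaw.indepFun_of_covariance_eval (P := μ)
    (X := fun a ω => A.mulVec (X ω) a) (Y := fun b ω => B.mulVec (X ω) b) ?_ ?_
  · exact this
  · exact hg.map_fun ((Matrix.mulVecLin A).toContinuousLinearMap.prod
      (Matrix.mulVecLin B).toContinuousLinearMap)
  · intro a b
    rw [← hAB a b]
    exact zmg_cov hX h hC (A a) (B b)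

/-- conditional law of `h + r` given a σ-algebra with `h` measurable, `r` independent. -/
lemma condExp_add_indep {Ω' : Type*} {d : ℕ} (m' : MeasurableSpace Ω') {mΩ : MeasurableSpace Ω'} {μ : Measure Ω'} [IsProbabilityMeasure μ]
    (hm' : m' ≤ mΩ) (h r : Ω' → Fin d → ℝ)
    (hh : Measurable[m'] h) (hr : Measurable r)
    (hi : Indep (MeasurableSpace.comap r inferInstance) m' μ)
    (A : Set (Fin d → ℝ)) (hA : MeasurableSet A) :
    (fun ω => (μ.map r).real {y | h ω + y ∈ A}) =ᵐ[μ]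
      μ[A.indicator (fun _ => (1 : ℝ)) ∘ (fun ω => h ω + r ω) | m'] := by
  have hhm : Measurable h := hh.mono hm' le_rfl
  have hid : Measurable[mΩ, m'] (id : Ω' → Ω') := measurable_id'' hm'
  have hpr : IsProbabilityMeasure (μ.map r) := Measure.isProbabilityMeasure_map hr.aemeasurable
  have hE : MeasurableSet[(m').prod inferInstance] {p : Ω' × (Fin d → ℝ) | h p.1 + p.2 ∈ A} := by
    have : Measurable[(m').prod inferInstance] (fun p : Ω' × (Fin d → ℝ) => h p.1 + p.2) := by
      let _ := m'
      fun_prop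
    exact this hA
  have hgm' : ∀ (ν : Measure (Fin d → ℝ)) [IsProbabilityMeasure ν],
      Measurable[m'] (fun ω => ν {y | h ω + y ∈ A}) := fun ν _ =>
    @measurable_measure_prodMk_left _ _ m' _ ν _ _ hE
  have hgm := hgm' (μ.map r)
  have hset : Measurable (fun ω => h ω + r ω) := hhm.add hr
  have hind : A.indicator (fun _ => (1 : ℝ)) ∘ (fun ω => h ω + r ω) =
    ((fun ω => h ω + r ω) ⁻¹' A).indicator (fun _ => (1 : ℝ)) := by
    ext ω; rfl
  have hiF : @IndepFun Ω' Ω' (Fin d → ℝ) mΩ m' _ id r μ := by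
    refine (@IndepFun_iff_Indep _ _ _ mΩ m' _ _ _ _).2 ?_
    have : MeasurableSpace.comap id m' = m' := MeasurableSpace.comap_id
    rw [this]; exact hi.symm
  have hprod := (@indepFun_iff_map_prod_eq_prod_map_map _ _ _ mΩ _ _ _ m' _ _
    (@Measurable.aemeasurable _ _ mΩ m' _ _ hid) hr.aemeasurable).1 hiF
  have hgreal : Measurable[m'] (fun ω => (μ.map r).real {y | h ω + y ∈ A}) := hgm.ennreal_toReal
  have hgint : Integrable (fun ω => (μ.map r).real {y | h ω + y ∈ A}) μ := by
    refine Integrable.of_bound (hgreal.mono hm' le_rfl).aestronglyMeasurable 1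
      (Filter.Eventually.of_forall fun ω => ?_)
    rw [Real.norm_of_nonneg measureReal_nonneg]
    exact measureReal_le_one
  refine ae_eq_condExp_of_forall_setIntegral_eq hm' ?_ ?_ ?_ ?_
  · rw [hind]
    exact (integrable_const 1).indicator (hset hA)
  · intro s _ _; exact hgint.integrableOn
  · intro s hs _
    rw [hind, integral_indicator (hset hA), Measure.restrict_restrict (hset hA)]
    simp only [integral_const, smul_eq_mul, mul_one, measureReal_def]
    rw [integral_toReal]
    rotate_left
    · exact (hgm.mono hm' le_rfl).aemeasurable
    · exact Filter.Eventually.of_forall fun ω => measure_lt_top _ _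
    simp only [Measure.restrict_apply MeasurableSet.univ, Set.univ_inter]
    congr 1
    have hE2 : MeasurableSet[(m').prod inferInstance]
        {p : Ω' × (Fin d → ℝ) | p.1 ∈ s ∧ h p.1 + p.2 ∈ A} := by
      let _ := m'
      exact (measurable_fst hs).inter hE
    have key := congrArg (fun ν => ν {p : Ω' × (Fin d → ℝ) | p.1 ∈ s ∧ h p.1 + p.2 ∈ A}) hprod
    rw [Measure.map_apply (hid.prodMk hr) hE2] at key
    have e1 : (fun ω => h ω + r ω) ⁻¹' A ∩ s =
      (fun ω => (id ω, r ω)) ⁻¹' {p : Ω' × (Fin d → ℝ) | p.1 ∈ s ∧ h p.1 + p.2 ∈ A} := by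
      ext ω; simp [and_comm]
    rw [e1, key, @Measure.prod_apply _ _ m' _ _ _ _ _ hE2]
    rw [@lintegral_map _ _ mΩ m' _ _ _ (by let _ := m'; exact measurable_measure_prodMk_left hE2) hid]
    rw [← lintegral_indicator (hm' _ hs)]
    congr 1
    ext ω
    by_cases hω : ω ∈ s <;> simp [hω]
  · exact hgreal.stronglyMeasurable.aestronglyMeasurable

end Prob

section CondLin

lemma stack_measurable {N d : ℕ} {x : ℕ → Ω → Fin d → ℝ}
    (hm : ∀ k, k ≤ N → Measurable (x k)) : Measurable (stack N d x) := by
  refine measurable_pi_lambda _ fun p => ?_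
  have := hm p.1 (Nat.lt_succ_iff.1 p.1.2)
  exact (measurable_pi_apply p.2).comp this

open Classical in
/-- selection of the coordinates at times in `S`. -/
noncomputable def maskM (N d : ℕ) (S : Set ℕ) :
    Matrix (Fin (N + 1) × Fin d) (Fin (N + 1) × Fin d) ℝ :=
  Matrix.diagonal (fun p => if (p.1 : ℕ) ∈ S then 1 else 0)

lemma sigmaOf_le {N d : ℕ} {x : ℕ → Ω → Fin d → ℝ}
    (hm : ∀ k, k ≤ N → Measurable (x k)) {S : Set ℕ} (hS : ∀ i ∈ S, i ≤ N) :
    sigmaOf x S ≤ ‹MeasurableSpace Ω› := by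
  refine iSup₂_le fun i hi => ?_
  exact (hm i (hS i hi)).comap_le

lemma sigmaOf_meas {d : ℕ} {x : ℕ → Ω → Fin d → ℝ} {S : Set ℕ} {i : ℕ} (hi : i ∈ S) :
    Measurable[sigmaOf x S] (x i) :=
  Measurable.mono (comap_measurable (x i))
    (le_iSup₂_of_le (f := fun i (_ : i ∈ S) => MeasurableSpace.comap (x i) inferInstance)
      i hi le_rfl) le_rfl

lemma sigmaOf_le_comap {N d : ℕ} {x : ℕ → Ω → Fin d → ℝ} {S : Set ℕ} (hS : ∀ i ∈ S, i ≤ N) :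
    sigmaOf x S ≤ MeasurableSpace.comap
      (fun ω => (maskM N d S).mulVec (stack N d x ω)) inferInstance := by
  refine iSup₂_le fun i hi => ?_
  have hx : x i = (fun v : Fin (N + 1) × Fin d → ℝ => fun a : Fin d =>
      v (⟨i, Nat.lt_succ_of_le (hS i hi)⟩, a)) ∘
        (fun ω => (maskM N d S).mulVec (stack N d x ω)) := by
    ext ω a
    simp [maskM, Matrix.mulVec_diagonal, stack, hi]
  rw [hx, ← MeasurableSpace.comap_comp]
  exact MeasurableSpace.comap_mono (Measurable.comap_le (by fun_prop))

lemma sigmaOf_lin_meas {N d : ℕ} {x : ℕ → Ω → Fin d → ℝ} {S : Set ℕ}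
    (l : Fin (N + 1) × Fin d → ℝ) (hl : ∀ p, (p.1 : ℕ) ∉ S → l p = 0) :
    Measurable[sigmaOf x S] (fun ω => ∑ p, l p * stack N d x ω p) := by
  refine Finset.measurable_fun_sum _ fun p _ => ?_
  by_cases hp : (p.1 : ℕ) ∈ S
  · exact ((measurable_pi_apply p.2).comp (sigmaOf_meas hp)).const_mul _
  · simp [hl p hp]

lemma indep_sigmaOf {N d : ℕ} {μ : Measure Ω} [IsProbabilityMeasure μ]
    {x : ℕ → Ω → Fin d → ℝ} {C : Matrix (Fin (N + 1) × Fin d) (Fin (N + 1) × Fin d) ℝ}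
    (hx : ZMNG N d μ x C) {κ : Type*} [Fintype κ] (ρ : Matrix κ (Fin (N + 1) × Fin d) ℝ)
    {S : Set ℕ} (hS : ∀ i ∈ S, i ≤ N)
    (h : ∀ a p, (p.1 : ℕ) ∈ S → C.mulVec (ρ a) p = 0) :
    Indep (MeasurableSpace.comap (fun ω => ρ.mulVec (stack N d x ω)) inferInstance)
      (sigmaOf x S) μ := by
  refine indep_of_indep_of_le_right ?_ (sigmaOf_le_comap hS)
  refine (IndepFun_iff_Indep _ _ _).1 ?_
  refine zmg_indep (stack_measurable hx.1) hx.2.1 hx.2.2 ρ (maskM N d S) fun a p => ?_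
  have hs : C.IsSymm := by
    have := hx.2.2.isHermitian
    rwa [Matrix.IsHermitian, Matrix.conjTranspose_eq_transpose_of_trivial] at this
  rw [Matrix.dotProduct_mulVec, ← Matrix.mulVec_transpose, hs]
  classical
  simp only [dotProduct, maskM, Matrix.diagonal_apply]
  refine Finset.sum_eq_zero fun q _ => ?_
  by_cases hpq : p = q
  · subst hpq
    by_cases hp : (p.1 : ℕ) ∈ S
    · rw [h a p hp]; simp
    · simp [hp]
  · simp [hpq]

lemma condEq_of_residual {N d : ℕ} {μ : Measure Ω} [IsProbabilityMeasure μ]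
    {x : ℕ → Ω → Fin d → ℝ} {C : Matrix (Fin (N + 1) × Fin d) (Fin (N + 1) × Fin d) ℝ}
    (hx : ZMNG N d μ x C) (k : Fin (N + 1)) {S T : Set ℕ} (hS : ∀ i ∈ S, i ≤ N) (hTS : T ⊆ S)
    (ρ : Matrix (Fin d) (Fin (N + 1) × Fin d) ℝ)
    (h1 : ∀ a b, ρ a (k, b) = if a = b then 1 else 0)
    (h2 : ∀ a p, (p.1 : ℕ) ∉ T → p.1 ≠ k → ρ a p = 0)
    (h3 : ∀ a p, (p.1 : ℕ) ∈ S → C.mulVec (ρ a) p = 0) :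
    CondEq μ x k S T := by
  intro A hA
  have hT : ∀ i ∈ T, i ≤ N := fun i hi => hS i (hTS hi)
  have hst := stack_measurable hx.1
  have hr : Measurable (fun ω => ρ.mulVec (stack N d x ω)) := by
    refine measurable_pi_lambda _ fun a => ?_
    simp only [Matrix.mulVec, dotProduct]
    fun_prop
  have hh : Measurable[sigmaOf x T] (fun ω => x k ω - ρ.mulVec (stack N d x ω)) := by
    refine @measurable_pi_lambda _ _ _ (sigmaOf x T) _ _ fun a => ?_
    have := sigmaOf_lin_meas (N := N) (x := x) (S := T)
      (fun p => if p.1 = k then (0:ℝ) else - ρ a p) (by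
        intro p hp
        by_cases hpk : p.1 = k
        · simp [hpk]
        · simp [hpk, h2 a p hp hpk])
    convert this using 2 with ω
    simp only [Pi.sub_apply, Matrix.mulVec, dotProduct]
    have e : ∀ p : Fin (N+1) × Fin d, ρ a p * stack N d x ω p =
      (if p.1 = k then ρ a p * stack N d x ω p else 0) -
      (if p.1 = k then (0:ℝ) else - ρ a p) * stack N d x ω p := by
      intro p; split_ifs <;> ring
    rw [Finset.sum_congr rfl fun p _ => e p, Finset.sum_sub_distrib]
    have e2 : ∑ p : Fin (N+1) × Fin d, (if p.1 = k then ρ a p * stack N d x ω p else 0) =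
        x k ω a := by
      rw [Fintype.sum_prod_type, Finset.sum_eq_single k]
      · simp [h1, stack]
      · intro b _ hb; simp [hb]
      · simp
    rw [e2]; ring
  have hh' : Measurable[sigmaOf x S] (fun ω => x k ω - ρ.mulVec (stack N d x ω)) := by
    refine Measurable.mono hh ?_ le_rfl
    exact biSup_mono hTS
  have hxk : x k = fun ω => (x k ω - ρ.mulVec (stack N d x ω)) + ρ.mulVec (stack N d x ω) := by
    ext ω a; simp
  have c1 := condExp_add_indep (sigmaOf x S) (sigmaOf_le hx.1 hS) _ _ hh' hr
    (indep_sigmaOf hx ρ hS h3) A hA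
  have c2 := condExp_add_indep (sigmaOf x T) (sigmaOf_le hx.1 hT) _ _ hh hr
    (indep_sigmaOf hx ρ hT fun a p hp => h3 a p (hTS hp)) A hA
  rw [← hxk] at c1 c2
  exact c1.symm.trans c2

lemma cov_of_condEq {N d : ℕ} {μ : Measure Ω} [IsProbabilityMeasure μ]
    {x : ℕ → Ω → Fin d → ℝ} {C : Matrix (Fin (N + 1) × Fin d) (Fin (N + 1) × Fin d) ℝ}
    (hx : ZMNG N d μ x C) (k : Fin (N + 1)) {S T : Set ℕ} (hS : ∀ i ∈ S, i ≤ N) (hTS : T ⊆ S)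
    (hc : CondEq μ x k S T) (l : Fin (N + 1) × Fin d → ℝ)
    (h1 : ∀ p, (p.1 : ℕ) ∉ S → l p = 0)
    (h2 : ∀ p, (p.1 : ℕ) ∈ T → C.mulVec l p = 0) (a : Fin d) :
    C.mulVec l (k, a) = 0 := by
  have hT : ∀ i ∈ T, i ≤ N := fun i hi => hS i (hTS hi)
  have hst := stack_measurable hx.1
  have hkm : Measurable (x k) := hx.1 k (Nat.lt_succ_iff.1 k.2)
  set w : Ω → ℝ := fun ω => ∑ p, l p * stack N d x ω p with hw
  have hwS : Measurable[sigmaOf x S] w := sigmaOf_lin_meas l h1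
  have hw2 : MemLp w 2 μ := zmg_memLp hst hx.2.1 l
  have hwi : Integrable w μ := hw2.integrable one_le_two
  have hw0 : ∫ ω, w ω ∂μ = 0 := zmg_integral hst hx.2.1 l
  have hind := indep_sigmaOf hx (κ := Unit) (fun _ => l) hT (fun _ p hp => h2 p hp)
  have hA : ∀ A : Set (Fin d → ℝ), MeasurableSet A → ∫ ω in x k ⁻¹' A, w ω ∂μ = 0 := by
    intro A hA
    have hAk : MeasurableSet (x k ⁻¹' A) := hkm hA
    have hf : (A.indicator (fun _ => (1:ℝ)) ∘ x k) = (x k ⁻¹' A).indicator (fun _ => (1:ℝ)) := by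
      ext ω; rfl
    have hfi : Integrable (A.indicator (fun _ => (1:ℝ)) ∘ x k) μ := by
      rw [hf]; exact (integrable_const 1).indicator hAk
    have hprod : (A.indicator (fun _ => (1:ℝ)) ∘ x k) * w = (x k ⁻¹' A).indicator w := by
      rw [hf]; ext ω; simp only [Pi.mul_apply, Set.indicator]; split_ifs <;> simp
    have hpi : Integrable ((A.indicator (fun _ => (1:ℝ)) ∘ x k) * w) μ := by
      rw [hprod]; exact hwi.indicator hAk
    have p1 := condExp_mul_of_stronglyMeasurable_right (m := sigmaOf x S)
      hwS.stronglyMeasurable hpi hfi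
    have p2 : μ[(A.indicator (fun _ => (1:ℝ)) ∘ x k) * w | sigmaOf x S] =ᵐ[μ]
        μ[A.indicator (fun _ => (1 : ℝ)) ∘ x k | sigmaOf x T] * w := by
      filter_upwards [p1, hc A hA] with ω q1 q2
      rw [q1, Pi.mul_apply, Pi.mul_apply, q2]
    rw [← integral_indicator hAk, ← hprod, ← integral_condExp (sigmaOf_le hx.1 hS),
      integral_congr_ae p2]
    have hI : IndepFun (μ[A.indicator (fun _ => (1 : ℝ)) ∘ x k | sigmaOf x T]) w μ := by
      refine (IndepFun_iff_Indep _ _ _).2 ?_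
      refine indep_of_indep_of_le_right (indep_of_indep_of_le_left hind.symm ?_) ?_
      · exact stronglyMeasurable_condExp.measurable.comap_le
      · have : w = (fun v : Unit → ℝ => v ()) ∘
          (fun ω => Matrix.mulVec (fun _ : Unit => l) (stack N d x ω)) := by
          ext ω; simp [hw, Matrix.mulVec, dotProduct]
        rw [this, ← MeasurableSpace.comap_comp]
        exact MeasurableSpace.comap_mono (Measurable.comap_le (by fun_prop))
    rw [hI.integral_mul_eq_mul_integral integrable_condExp.aestronglyMeasurable
      hwi.aestronglyMeasurable, hw0, mul_zero]
  have hcond : μ[w | MeasurableSpace.comap (x k) inferInstance] =ᵐ[μ] 0 := by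
    refine (ae_eq_condExp_of_forall_setIntegral_eq hkm.comap_le hwi ?_ ?_ ?_).symm
    · intro s _ _; exact integrableOn_zero
    · rintro s ⟨A, hA', rfl⟩ _
      rw [hA A hA']; simp
    · exact aestronglyMeasurable_zero
  have hxa : (fun ω => x k ω a) = fun ω => ∑ p, (Pi.single (k, a) (1:ℝ) : _ → ℝ) p *
      stack N d x ω p := by
    ext ω; simp [Pi.single_apply, stack]
  have hx2 : MemLp (fun ω => x k ω a) 2 μ := by
    rw [hxa]; exact zmg_memLp hst hx.2.1 _
  have hxi : ∫ ω, x k ω a ∂μ = 0 := by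
    rw [hxa]; exact zmg_integral hst hx.2.1 _
  have hcov : cov[fun ω => x k ω a, w; μ] = C.mulVec l (k, a) := by
    rw [hxa, zmg_cov hst hx.2.1 hx.2.2]; simp
  rw [← hcov, covariance_eq_sub hx2 hw2, hw0, mul_zero, sub_zero,
    ← integral_condExp hkm.comap_le]
  have hxm : StronglyMeasurable[MeasurableSpace.comap (x k) inferInstance] (fun ω => x k ω a) :=
    ((measurable_pi_apply a).comp (comap_measurable (x k))).stronglyMeasurable
  have p1 := condExp_mul_of_stronglyMeasurable_left hxm (hx2.integrable_mul hw2) hwi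
  rw [integral_congr_ae p1]
  have : (fun ω => x k ω a) * μ[w | MeasurableSpace.comap (x k) inferInstance] =ᵐ[μ] 0 := by
    filter_upwards [hcond] with ω hω
    simp [hω]
  rw [integral_congr_ae this]; simp

end CondLin

section Recip

/-- cyclic tri-diagonality, entrywise. -/
def Cyc (N d : ℕ) (Q : Matrix (Fin (N + 1) × Fin d) (Fin (N + 1) × Fin d) ℝ) : Prop :=
  ∀ p q : Fin (N + 1) × Fin d, 1 ≤ (p.1 : ℕ) → (p.1 : ℕ) < N → (q.1 : ℕ) + 1 ≠ (p.1 : ℕ) →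
    (q.1 : ℕ) ≠ (p.1 : ℕ) → (q.1 : ℕ) ≠ (p.1 : ℕ) + 1 → Q p q = 0

lemma cyc_of_recip {N d : ℕ} {μ : Measure Ω} [IsProbabilityMeasure μ]
    {x : ℕ → Ω → Fin d → ℝ} {C : Matrix (Fin (N + 1) × Fin d) (Fin (N + 1) × Fin d) ℝ}
    (hx : ZMNG N d μ x C) (hr : IsReciprocal μ x N) : Cyc N d C⁻¹ := by
  rintro ⟨k, a⟩ ⟨i, b⟩ hk1 hkN h1 h2 h3
  simp only at hk1 hkN h1 h2 h3
  have hQ : (C⁻¹).PosDef := hx.2.2.inv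
  have hCu : IsUnit C.det := (Matrix.isUnit_iff_isUnit_det _).1 hx.2.2.isUnit
  set Q := C⁻¹ with hQdef
  have hki : i ≠ k := fun h => h2 (by rw [h])
  have hc := hr (k - 1) k (k + 1) (by omega) (by omega) (by omega)
  set B : Mat d := Q.submatrix (fun a => (k, a)) (fun a => (k, a)) with hB
  have hBp : B.PosDef := hQ.submatrix (fun a b h => by simpa using h)
  have hBu : IsUnit B.det := (Matrix.isUnit_iff_isUnit_det _).1 hBp.isUnit
  set c : Fin d → ℝ := fun a => Q (k, a) (i, b) with hcdef
  set z : Fin d → ℝ := - B⁻¹.mulVec c with hz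
  set u : Fin (N + 1) × Fin d → ℝ := fun p => if p.1 = k then z p.2 else
    if p = (i, b) then 1 else 0 with hu
  have hQu : ∀ a', Q.mulVec u (k, a') = 0 := by
    intro a'
    have e : ∀ p : Fin (N + 1) × Fin d, Q (k, a') p * u p =
        (if p.1 = k then Q (k, a') p * z p.2 else 0) + (if p = (i, b) then Q (k, a') p else 0) := by
      intro p
      simp only [hu]
      by_cases hp : p.1 = k
      · have : p ≠ (i, b) := by rintro rfl; exact hki hp
        simp [hp, this]
      · simp [hp]
    simp only [Matrix.mulVec, dotProduct]
    rw [Finset.sum_congr rfl fun p _ => e p, Finset.sum_add_distrib, Fintype.sum_prod_type,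
      Finset.sum_eq_single k]
    · have : B.mulVec z a' + c a' = 0 := by
        rw [hz, Matrix.mulVec_neg, Matrix.mulVec_mulVec, Matrix.mul_nonsing_inv _ hBu]
        simp
      simpa [Matrix.mulVec, dotProduct, hB, hcdef] using this
    · intro j _ hj; simp [hj]
    · simp
  have hCQ : C.mulVec (Q.mulVec u) = u := by
    rw [Matrix.mulVec_mulVec, hQdef, Matrix.mul_nonsing_inv _ hCu, Matrix.one_mulVec]
  have key := cov_of_condEq hx k (S := Set.Icc 0 ((k:ℕ) - 1) ∪ Set.Icc ((k:ℕ) + 1) N)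
    (T := {(k:ℕ) - 1} ∪ {(k:ℕ) + 1}) (by
      intro i hi
      simp only [Set.mem_union, Set.mem_Icc] at hi
      omega) (by
      intro i hi
      simp only [Set.mem_union, Set.mem_Icc, Set.mem_singleton_iff] at hi ⊢
      omega) hc (Q.mulVec u) (by
      rintro ⟨j, a'⟩ hj
      simp only [Set.mem_union, Set.mem_Icc] at hj
      have : j = k := by apply Fin.ext; have := j.2; omega
      rw [this]; exact hQu a') (by
      intro p hp
      rw [hCQ]
      simp only [Set.mem_union, Set.mem_singleton_iff] at hp
      have p1 : p.1 ≠ k := by rintro h; rw [h] at hp; omega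
      have p2 : p ≠ (i, b) := by rintro rfl; simp only at hp; omega
      simp [hu, p1, p2])
  have hz0 : z = 0 := by
    ext a'
    have := key a'
    rw [hCQ] at this
    simpa [hu] using this
  have : c = 0 := by
    have h : B.mulVec z = 0 := by rw [hz0]; simp
    rw [hz, Matrix.mulVec_neg, Matrix.mulVec_mulVec, Matrix.mul_nonsing_inv _ hBu] at h
    simpa using h
  exact congrFun this a

lemma recip_of_cyc {N d : ℕ} {μ : Measure Ω} [IsProbabilityMeasure μ]
    {x : ℕ → Ω → Fin d → ℝ} {C : Matrix (Fin (N + 1) × Fin d) (Fin (N + 1) × Fin d) ℝ}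
    (hx : ZMNG N d μ x C) (hcyc : Cyc N d C⁻¹) : IsReciprocal μ x N := by
  intro j k l hjk hkl hlN
  have hQ : (C⁻¹).PosDef := hx.2.2.inv
  have hCu : IsUnit C.det := (Matrix.isUnit_iff_isUnit_det _).1 hx.2.2.isUnit
  set Q := C⁻¹ with hQdef
  have hQs : Q.IsSymm := by
    have := hQ.isHermitian
    rwa [Matrix.IsHermitian, Matrix.conjTranspose_eq_transpose_of_trivial] at this
  let J := {p : Fin (N + 1) × Fin d // j < (p.1 : ℕ) ∧ (p.1 : ℕ) < l}
  set B : Matrix J J ℝ := Q.submatrix Subtype.val Subtype.val with hB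
  have hBp : B.PosDef := hQ.submatrix Subtype.val_injective
  have hBu : IsUnit B.det := (Matrix.isUnit_iff_isUnit_det _).1 hBp.isUnit
  have hkN : k < N + 1 := by omega
  let kk : Fin (N + 1) := ⟨k, hkN⟩
  let v : Fin d → J → ℝ := fun a => B⁻¹.mulVec (Pi.single ⟨(kk, a), hjk, hkl⟩ 1)
  have hv : ∀ a, B.mulVec (v a) = Pi.single ⟨(kk, a), hjk, hkl⟩ 1 := by
    intro a
    simp only [v]
    rw [Matrix.mulVec_mulVec, Matrix.mul_nonsing_inv _ hBu, Matrix.one_mulVec]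
  let u : Fin d → Fin (N + 1) × Fin d → ℝ := fun a p =>
    if h : j < (p.1 : ℕ) ∧ (p.1 : ℕ) < l then v a ⟨p, h⟩ else 0
  have hQu : ∀ a p, Q.mulVec (u a) p = ∑ q : J, Q p q.1 * v a q := by
    intro a p
    simp only [Matrix.mulVec, dotProduct]
    rw [← Fintype.sum_subtype_add_sum_subtype (fun p : Fin (N + 1) × Fin d =>
      j < (p.1 : ℕ) ∧ (p.1 : ℕ) < l)]
    have z1 : ∑ q : {q : Fin (N + 1) × Fin d // ¬ (j < (q.1 : ℕ) ∧ (q.1 : ℕ) < l)},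
        Q p q.1 * u a q.1 = 0 := by
      refine Finset.sum_eq_zero fun q _ => ?_
      simp only [u]
      rw [dif_neg q.2, mul_zero]
    rw [z1, add_zero]
    refine Finset.sum_congr rfl fun q _ => ?_
    simp only [u]
    rw [dif_pos q.2]
  have hQin : ∀ a (p : J), Q.mulVec (u a) p.1 =
      (Pi.single ⟨(kk, a), hjk, hkl⟩ 1 : J → ℝ) p := by
    intro a p
    rw [hQu, ← hv a]
    rfl
  have hCQ : ∀ a, C.mulVec (Q.mulVec (u a)) = u a := by
    intro a
    rw [Matrix.mulVec_mulVec, hQdef, Matrix.mul_nonsing_inv _ hCu, Matrix.one_mulVec]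
  refine condEq_of_residual hx kk (S := Set.Icc 0 j ∪ Set.Icc l N) (T := {j} ∪ {l}) ?_ ?_
    (fun a => Q.mulVec (u a)) ?_ ?_ ?_
  · intro i hi
    simp only [Set.mem_union, Set.mem_Icc] at hi
    omega
  · intro i hi
    simp only [Set.mem_union, Set.mem_Icc, Set.mem_singleton_iff] at hi ⊢
    omega
  · intro a b
    have := hQin a ⟨(kk, b), hjk, hkl⟩
    simp only at this
    rw [this, Pi.single_apply]
    by_cases hab : a = b
    · subst hab
      simp
    · rw [if_neg, if_neg]
      · first | exact hab | exact fun h => hab h.symm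
      · intro h
        apply hab
        have := congrArg Prod.snd (congrArg Subtype.val h)
        simpa [eq_comm] using this
  · intro a p hp hpk
    simp only [Set.mem_union, Set.mem_singleton_iff, not_or] at hp
    by_cases hJ : j < (p.1 : ℕ) ∧ (p.1 : ℕ) < l
    · have := hQin a ⟨p, hJ⟩
      simp only at this
      rw [this, Pi.single_apply, if_neg]
      intro h
      apply hpk
      have := congrArg Subtype.val h
      exact congrArg Prod.fst this
    · rw [hQu]
      refine Finset.sum_eq_zero fun q _ => ?_
      have hq := q.2
      have : Q q.1 p = 0 := hcyc q.1 p (by omega) (by omega) (by omega) (by omega) (by omega)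
      rw [← hQs.apply, this, zero_mul]
  · intro a p hp
    rw [hCQ]
    simp only [Set.mem_union, Set.mem_Icc] at hp
    simp only [u]
    rw [dif_neg]
    omega

end Recip

section Blocks

/-- the `d × d` block `(i, j)`. -/
def bl {N d : ℕ} (A : Matrix (Fin (N + 1) × Fin d) (Fin (N + 1) × Fin d) ℝ) (i j : ℕ) : Mat d :=
  fun a b => A (Fin.ofNat (N + 1) i, a) (Fin.ofNat (N + 1) j, b)

/-- assemble blocks. -/
def ofB (N : ℕ) {d : ℕ} (f : ℕ → ℕ → Mat d) :
    Matrix (Fin (N + 1) × Fin d) (Fin (N + 1) × Fin d) ℝ :=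
  fun p q => f p.1 q.1 p.2 q.2

variable {N d : ℕ}

lemma ofNat_val_le {i : ℕ} (hi : i ≤ N) : ((Fin.ofNat (N + 1) i : Fin (N + 1)) : ℕ) = i := by
  simp [Fin.ofNat, Nat.mod_eq_of_lt (Nat.lt_succ_of_le hi)]

lemma ofNat_val_fin (i : Fin (N + 1)) : Fin.ofNat (N + 1) (i : ℕ) = i := by
  apply Fin.ext
  exact ofNat_val_le (Nat.lt_succ_iff.1 i.2)

lemma bl_apply (A : Matrix (Fin (N + 1) × Fin d) (Fin (N + 1) × Fin d) ℝ)
    (i j : Fin (N + 1)) (a b : Fin d) : bl A i j a b = A (i, a) (j, b) := by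
  simp only [bl, ofNat_val_fin]

lemma bl_ext {A B : Matrix (Fin (N + 1) × Fin d) (Fin (N + 1) × Fin d) ℝ}
    (h : ∀ i j, i ≤ N → j ≤ N → bl A i j = bl B i j) : A = B := by
  ext ⟨i, a⟩ ⟨j, b⟩
  have := h i j (Nat.lt_succ_iff.1 i.2) (Nat.lt_succ_iff.1 j.2)
  rw [← bl_apply A, this, bl_apply]

lemma bl_ofB (f : ℕ → ℕ → Mat d) {i j : ℕ} (hi : i ≤ N) (hj : j ≤ N) :
    bl (ofB N f) i j = f i j := by
  ext a b
  simp only [bl, ofB, ofNat_val_le hi, ofNat_val_le hj]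

lemma bl_mul (A B : Matrix (Fin (N + 1) × Fin d) (Fin (N + 1) × Fin d) ℝ) (i j : ℕ) :
    bl (A * B) i j = ∑ k ∈ Finset.range (N + 1), bl A i k * bl B k j := by
  ext a b
  rw [Finset.sum_range, Matrix.sum_apply]
  simp only [bl, Matrix.mul_apply, Fintype.sum_prod_type, ofNat_val_fin]

lemma bl_transpose (A : Matrix (Fin (N + 1) × Fin d) (Fin (N + 1) × Fin d) ℝ) (i j : ℕ) :
    bl Aᵀ i j = (bl A j i)ᵀ := rfl

lemma bl_one {i j : ℕ} (hi : i ≤ N) (hj : j ≤ N) :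
    bl (1 : Matrix (Fin (N + 1) × Fin d) (Fin (N + 1) × Fin d) ℝ) i j = if i = j then 1 else 0 := by
  ext a b
  have : (Fin.ofNat (N + 1) i : Fin (N + 1)) = Fin.ofNat (N + 1) j ↔ i = j := by
    rw [Fin.ext_iff, ofNat_val_le hi, ofNat_val_le hj]
  simp only [bl, Matrix.one_apply, Prod.mk.injEq, this]
  by_cases h : i = j <;> simp [h, Matrix.one_apply]

lemma blockDiag_eq (G : ℕ → Mat d) :
    blockDiag N d G = ofB N (fun i j => if i = j then G i else 0) := by
  ext p q
  simp only [blockDiag, ofB]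
  split_ifs <;> simp

lemma bl_blockDiag (G : ℕ → Mat d) {i j : ℕ} (hi : i ≤ N) (hj : j ≤ N) :
    bl (blockDiag N d G) i j = if i = j then G i else 0 := by
  rw [blockDiag_eq, bl_ofB _ hi hj]

lemma bl_diag_mul (G : ℕ → Mat d) (A : Matrix (Fin (N + 1) × Fin d) (Fin (N + 1) × Fin d) ℝ)
    {i : ℕ} (hi : i ≤ N) (j : ℕ) : bl (blockDiag N d G * A) i j = G i * bl A i j := by
  rw [bl_mul, Finset.sum_eq_single i]
  · rw [bl_blockDiag _ hi hi, if_pos rfl]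
  · intro k hk hki
    rw [bl_blockDiag _ hi (by simpa [Nat.lt_succ_iff] using hk), if_neg (Ne.symm hki), zero_mul]
  · intro h
    exact absurd (Finset.mem_range.2 (Nat.lt_succ_of_le hi)) h

lemma diag_inv_mul {G : ℕ → Mat d} (hG : ∀ k, k ≤ N → (G k).PosDef) :
    blockDiag N d (fun k => (G k)⁻¹) * blockDiag N d G = 1 := by
  refine bl_ext fun i j hi hj => ?_
  rw [bl_diag_mul _ _ hi, bl_blockDiag _ hi hj, bl_one hi hj]
  split_ifs
  · exact Matrix.nonsing_inv_mul _ ((Matrix.isUnit_iff_isUnit_det _).1 (hG i hi).isUnit)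
  · simp

/-- blocks of the model operator. -/
def Tb (N : ℕ) {d : ℕ} (Gm GN : ℕ → Mat d) (i j : ℕ) : Mat d :=
  (if j = i then 1 else 0) + (if j = i - 1 then (if 1 ≤ i ∧ i < N then -Gm i else 0) else 0) +
    (if j = N then (if i < N then -GN i else 0) else 0)

lemma Tsum {M : Type*} [AddCommMonoid M] (f : ℕ → Mat d → M) (h0 : ∀ j, f j 0 = 0)
    (ha : ∀ j A B, f j (A + B) = f j A + f j B) (Gm GN : ℕ → Mat d) {i : ℕ} (hi : i ≤ N) :
    ∑ j ∈ Finset.range (N + 1), f j (Tb N Gm GN i j) =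
      f i 1 + f (i - 1) (if 1 ≤ i ∧ i < N then -Gm i else 0) +
        f N (if i < N then -GN i else 0) := by
  have hite : ∀ (j k : ℕ) (A : Mat d), f j (if j = k then A else 0) = if j = k then f k A else 0 := by
    intro j k A
    split_ifs with h
    · rw [h]
    · exact h0 j
  simp only [Tb, ha, Finset.sum_add_distrib, hite, Finset.sum_ite_eq', Finset.mem_range]
  rw [if_pos (show i < N + 1 by omega), if_pos (show i - 1 < N + 1 by omega),
    if_pos (show N < N + 1 by omega)]

lemma Tsum_col (S : ℕ → Mat d) (Gm GN : ℕ → Mat d) {i : ℕ} (h1 : 1 ≤ i) (hi : i < N) :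
    ∑ k ∈ Finset.range (N + 1), (Tb N Gm GN k i)ᵀ * S k =
      S i - (if i + 1 < N then (Gm (i + 1))ᵀ * S (i + 1) else 0) := by
  have : ∀ k ∈ Finset.range (N + 1), (Tb N Gm GN k i)ᵀ * S k =
      (if k = i then S i else 0) +
      (if k = i + 1 then (if i + 1 < N then -((Gm (i + 1))ᵀ * S (i + 1)) else 0) else 0) := by
    intro k _
    have h2 : (i = k - 1 ∧ (1 ≤ k ∧ k < N)) ↔ (k = i + 1 ∧ i + 1 < N) := by omega
    unfold Tb
    rw [if_neg (show ¬ i = N by omega), add_zero, ← ite_and, ← ite_and]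
    simp only [h2]
    by_cases hk : k = i
    · subst hk
      simp
    · rw [if_neg (fun h => hk h.symm), if_neg hk, zero_add, zero_add]
      split_ifs with h
      · rw [h.1]; simp
      · simp
  rw [Finset.sum_congr rfl this, Finset.sum_add_distrib, Finset.sum_ite_eq', Finset.sum_ite_eq',
    if_pos (by simp; omega), if_pos (by simp; omega)]
  split_ifs <;> simp [sub_eq_add_neg]

/-- the model operator. -/
def Tm (N : ℕ) {d : ℕ} (Gm GN : ℕ → Mat d) :
    Matrix (Fin (N + 1) × Fin d) (Fin (N + 1) × Fin d) ℝ := ofB N (Tb N Gm GN)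

lemma bl_Tm_mul (Gm GN : ℕ → Mat d) (A : Matrix (Fin (N + 1) × Fin d) (Fin (N + 1) × Fin d) ℝ)
    {i : ℕ} (hi : i ≤ N) (j : ℕ) :
    bl (Tm N Gm GN * A) i j = bl A i j + (if 1 ≤ i ∧ i < N then -Gm i else 0) * bl A (i - 1) j +
      (if i < N then -GN i else 0) * bl A N j := by
  rw [bl_mul]
  have := Tsum (N := N) (fun k B => B * bl A k j) (fun _ => zero_mul _) (fun _ _ _ => add_mul _ _ _)
    Gm GN hi
  rw [one_mul] at this
  rw [← this]
  refine Finset.sum_congr rfl fun k hk => ?_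
  rw [Tm, bl_ofB _ hi (by simpa [Nat.lt_succ_iff] using hk)]

lemma bl_mul_TmT (Gm GN : ℕ → Mat d) (A : Matrix (Fin (N + 1) × Fin d) (Fin (N + 1) × Fin d) ℝ)
    {j : ℕ} (hj : j ≤ N) (i : ℕ) :
    bl (A * (Tm N Gm GN)ᵀ) i j = bl A i j +
      bl A i (j - 1) * (if 1 ≤ j ∧ j < N then -Gm j else 0)ᵀ +
      bl A i N * (if j < N then -GN j else 0)ᵀ := by
  have := bl_Tm_mul Gm GN Aᵀ hj i
  have h2 : A * (Tm N Gm GN)ᵀ = (Tm N Gm GN * Aᵀ)ᵀ := by simp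
  rw [h2, bl_transpose, this]
  simp only [bl_transpose, Matrix.transpose_add, Matrix.transpose_mul, Matrix.transpose_transpose]

lemma bl_TmT_mul (Gm GN : ℕ → Mat d) (A : Matrix (Fin (N + 1) × Fin d) (Fin (N + 1) × Fin d) ℝ)
    {i : ℕ} (h1 : 1 ≤ i) (hi : i < N) (j : ℕ) :
    bl ((Tm N Gm GN)ᵀ * A) i j = bl A i j -
      (if i + 1 < N then (Gm (i + 1))ᵀ * bl A (i + 1) j else 0) := by
  rw [bl_mul, ← Tsum_col (fun k => bl A k j) Gm GN h1 hi]
  refine Finset.sum_congr rfl fun k hk => ?_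
  rw [bl_transpose, Tm, bl_ofB _ (by simpa [Nat.lt_succ_iff] using hk) hi.le]

lemma Tm_mulVec (Gm GN : ℕ → Mat d) (x : ℕ → Ω → Fin d → ℝ) (ω : Ω) {i : ℕ} (hi : i ≤ N) :
    (fun a => (Tm N Gm GN).mulVec (stack N d x ω) (Fin.ofNat (N + 1) i, a)) =
      x i ω + (if 1 ≤ i ∧ i < N then -Gm i else 0).mulVec (x (i - 1) ω) +
        (if i < N then -GN i else 0).mulVec (x N ω) := by
  have := Tsum (N := N) (fun k B => B.mulVec (x k ω)) (fun _ => Matrix.zero_mulVec _)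
    (fun _ _ _ => Matrix.add_mulVec _ _ _) Gm GN hi
  rw [Matrix.one_mulVec] at this
  rw [← this]
  ext a
  rw [Finset.sum_range, Finset.sum_apply]
  simp only [Matrix.mulVec, dotProduct, Fintype.sum_prod_type, Tm, ofB, stack, ofNat_val_le hi]

end Blocks

section Model

variable {N d : ℕ}

lemma lin_mulVec {ι : Type*} [Fintype ι] (T : Matrix ι ι ℝ) (l v : ι → ℝ) :
    ∑ i, l i * (T.mulVec v) i = ∑ i, (Tᵀ.mulVec l) i * v i := by
  change l ⬝ᵥ T.mulVec v = Tᵀ.mulVec l ⬝ᵥ v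
  rw [Matrix.dotProduct_mulVec, ← Matrix.mulVec_transpose]

lemma quad_mulVec {ι : Type*} [Fintype ι] (T C : Matrix ι ι ℝ) (l m : ι → ℝ) :
    (Tᵀ.mulVec l) ⬝ᵥ C.mulVec (Tᵀ.mulVec m) = l ⬝ᵥ (T * C * Tᵀ).mulVec m := by
  rw [← Matrix.mulVec_mulVec, ← Matrix.mulVec_mulVec, Matrix.dotProduct_mulVec l,
    ← Matrix.mulVec_transpose]

lemma cov_of_model {μ : Measure Ω} [IsProbabilityMeasure μ] {x : ℕ → Ω → Fin d → ℝ}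
    {C : Matrix (Fin (N + 1) × Fin d) (Fin (N + 1) × Fin d) ℝ} (hN : 3 ≤ N)
    (hx : ZMNG N d μ x C) {Gm GN Gcov : ℕ → Mat d} (h : CMLModel N d μ x Gm GN Gcov) :
    Tm N Gm GN * C * (Tm N Gm GN)ᵀ = blockDiag N d Gcov := by
  classical
  obtain ⟨hxm, hxg, hC⟩ := hx
  obtain ⟨e, ⟨hem, heg, hD⟩, hG, hae⟩ := h
  set T := Tm N Gm GN with hT
  have hst : ∀ᵐ ω ∂μ, stack N d e ω = T.mulVec (stack N d x ω) := by
    filter_upwards [hae] with ω hω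
    obtain ⟨h1, h2, h3⟩ := hω
    ext ⟨i, a⟩
    have hi : (i : ℕ) ≤ N := Nat.lt_succ_iff.1 i.2
    have := congrFun (Tm_mulVec (N := N) Gm GN x ω hi) a
    simp only [ofNat_val_fin] at this
    rw [hT, this]
    change e i ω a = _
    rcases Nat.eq_zero_or_pos (i : ℕ) with h0 | h0
    · rw [h0, if_neg (by omega), if_pos (by omega), h3]
      simp [Matrix.neg_mulVec]
    · rcases Nat.lt_or_ge (i : ℕ) N with h4 | h4
      · rw [if_pos ⟨h0, h4⟩, if_pos h4, h1 i h0 (by omega)]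
        simp [Matrix.neg_mulVec]
        ring
      · have : (i : ℕ) = N := by omega
        rw [this, if_neg (by omega), if_neg (by omega), h2]
        simp
  have hlin : ∀ l : Fin (N + 1) × Fin d → ℝ, (fun ω => ∑ i, l i * stack N d e ω i) =ᵐ[μ]
      (fun ω => ∑ i, (Tᵀ.mulVec l) i * stack N d x ω i) := by
    intro l
    filter_upwards [hst] with ω hω
    rw [hω, lin_mulVec]
  ext p q
  have h1 := zmg_cov (stack_measurable hem) heg hD (Pi.single p 1) (Pi.single q 1)
  have h2 := zmg_cov (stack_measurable hxm) hxg hC (Tᵀ.mulVec (Pi.single p 1))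
    (Tᵀ.mulVec (Pi.single q 1))
  have h3 : cov[fun ω => ∑ i, (Pi.single p (1 : ℝ) : _ → ℝ) i * stack N d e ω i,
      fun ω => ∑ i, (Pi.single q (1 : ℝ) : _ → ℝ) i * stack N d e ω i; μ] =
      cov[fun ω => ∑ i, (Tᵀ.mulVec (Pi.single p 1)) i * stack N d x ω i,
      fun ω => ∑ i, (Tᵀ.mulVec (Pi.single q 1)) i * stack N d x ω i; μ] := by
    have e1 := hlin (Pi.single p 1)
    have e2 := hlin (Pi.single q 1)
    unfold covariance
    rw [integral_congr_ae e1, integral_congr_ae e2]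
    apply integral_congr_ae
    filter_upwards [e1, e2] with ω w1 w2
    rw [w1, w2]
  rw [h1, h2, quad_mulVec] at h3
  simpa using h3.symm

lemma model_of_cov {μ : Measure Ω} [IsProbabilityMeasure μ] {x : ℕ → Ω → Fin d → ℝ}
    {C : Matrix (Fin (N + 1) × Fin d) (Fin (N + 1) × Fin d) ℝ} (hN : 3 ≤ N)
    (hx : ZMNG N d μ x C) {Gm GN Gcov : ℕ → Mat d} (hG : ∀ k, k ≤ N → (Gcov k).PosDef)
    (h : Tm N Gm GN * C * (Tm N Gm GN)ᵀ = blockDiag N d Gcov) :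
    CMLModel N d μ x Gm GN Gcov := by
  classical
  obtain ⟨hxm, hxg, hC⟩ := hx
  set T := Tm N Gm GN with hT
  have hst : ∀ ω, stack N d (fun i ω a => T.mulVec (stack N d x ω) (Fin.ofNat (N + 1) i, a)) ω =
      T.mulVec (stack N d x ω) := by
    intro ω
    ext ⟨i, a⟩
    simp only [stack, ofNat_val_fin]
  refine ⟨fun i ω a => T.mulVec (stack N d x ω) (Fin.ofNat (N + 1) i, a), ⟨?_, ?_, ?_⟩, hG, ?_⟩
  · intro k _
    have := stack_measurable hxm
    refine measurable_pi_lambda _ fun a => ?_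
    simp only [Matrix.mulVec, dotProduct]
    fun_prop
  · intro l
    simp only [hst, lin_mulVec]
    rw [hxg, quad_mulVec, h]
  · rw [← h, ← Matrix.conjTranspose_eq_transpose_of_trivial]
    refine hC.mul_mul_conjTranspose_same ?_
    rw [Matrix.vecMul_injective_iff_isUnit]
    have h1 := diag_inv_mul hG
    have h2 := mul_eq_one_comm.1 h1
    rw [← h, Matrix.mul_assoc, Matrix.mul_assoc] at h2
    exact IsUnit.of_mul_eq_one _ h2
  · refine Filter.Eventually.of_forall fun ω => ?_
    refine ⟨fun k h1 h2 => ?_, ?_, ?_⟩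
    · beta_reduce
      rw [hT, Tm_mulVec Gm GN x ω (show k ≤ N by omega), if_pos (by omega), if_pos (by omega)]
      simp only [Matrix.neg_mulVec]
      abel
    · beta_reduce
      rw [hT, Tm_mulVec Gm GN x ω le_rfl, if_neg (by omega), if_neg (by omega)]
      simp
    · beta_reduce
      rw [hT, Tm_mulVec Gm GN x ω (Nat.zero_le _), if_neg (by omega), if_pos (by omega)]
      simp [Matrix.neg_mulVec]

end Model

section Params

variable {N d : ℕ}

lemma MNk_self (Mm : ℕ → Mat d) : MNk d Mm N N = 1 := by simp [MNk]

lemma MNk_step (Mm : ℕ → Mat d) {k : ℕ} (hk : k < N) :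
    MNk d Mm N k = MNk d Mm N (k + 1) * Mm (k + 1) := by
  unfold MNk
  have h1 : N - k = (N - (k + 1)) + 1 := by omega
  rw [h1, List.range_succ, List.foldl_append]
  simp only [List.foldl_cons, List.foldl_nil]
  congr 2
  omega

lemma CNk_last (Mm Mcov : ℕ → Mat d) (hN : 1 ≤ N) : CNk d Mm Mcov N (N - 1) = Mcov N := by
  unfold CNk
  rw [Finset.Icc_self, Finset.sum_singleton, Nat.sub_add_cancel hN, MNk_self]
  simp

lemma CNk_step (Mm Mcov : ℕ → Mat d) {k : ℕ} (hk : k + 1 < N) :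
    CNk d Mm Mcov N k = CNk d Mm Mcov N (k + 1) +
      MNk d Mm N (k + 1) * Mcov (k + 1) * (MNk d Mm N (k + 1))ᵀ := by
  unfold CNk
  rw [← Finset.add_sum_Ioc_eq_sum_Icc (show k ≤ N - 1 by omega), add_comm]
  congr 1
  refine Finset.sum_congr ?_ fun _ _ => rfl
  ext n
  simp only [Finset.mem_Ioc, Finset.mem_Icc]
  omega

lemma CNk_posDef (Mm Mcov : ℕ → Mat d) (hM : ∀ k, 1 ≤ k → k ≤ N → (Mcov k).PosDef) :
    ∀ t k, k + t + 1 = N → (CNk d Mm Mcov N k).PosDef := by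
  intro t
  induction t with
  | zero =>
    intro k hk
    have : k = N - 1 := by omega
    rw [this, CNk_last _ _ (by omega)]
    exact hM N (by omega) le_rfl
  | succ t ih =>
    intro k hk
    rw [CNk_step _ _ (by omega)]
    refine (ih (k + 1) (by omega)).add_posSemidef ?_
    rw [← Matrix.conjTranspose_eq_transpose_of_trivial]
    exact (hM (k + 1) (by omega) (by omega)).posSemidef.mul_mul_conjTranspose_same _

lemma PosDef.symm' {ι : Type*} {A : Matrix ι ι ℝ} (h : A.PosDef) : Aᵀ = A := by
  have := h.isHermitian
  rwa [Matrix.IsHermitian, Matrix.conjTranspose_eq_transpose_of_trivial] at this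

lemma PosDef.det' {ι : Type*} [Fintype ι] [DecidableEq ι] {A : Matrix ι ι ℝ} (h : A.PosDef) :
    IsUnit A.det := (Matrix.isUnit_iff_isUnit_det _).1 h.isUnit

/-- the noise covariance is positive definite -/
lemma gcov_posDef {P H c : Mat d} (hP : P.PosDef) (hc : c.PosDef) :
    (P⁻¹ + Hᵀ * c⁻¹ * H).PosDef := by
  refine hP.inv.add_posSemidef ?_
  rw [← Matrix.conjTranspose_eq_transpose_of_trivial]
  exact hc.inv.posSemidef.conjTranspose_mul_mul_same _

lemma key_identity {P H c : Mat d} (hP : P.PosDef) (hc : c.PosDef) :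
    Hᵀ * (c + H * P * Hᵀ)⁻¹ = P⁻¹ * (P⁻¹ + Hᵀ * c⁻¹ * H)⁻¹ * Hᵀ * c⁻¹ := by
  have hS : (c + H * P * Hᵀ).PosDef := by
    refine hc.add_posSemidef ?_
    rw [← Matrix.conjTranspose_eq_transpose_of_trivial]
    exact hP.posSemidef.mul_mul_conjTranspose_same _
  set S := c + H * P * Hᵀ with hSd
  have hK := gcov_posDef (H := H) hP hc
  set K := P⁻¹ + Hᵀ * c⁻¹ * H with hKd
  have h1 : Hᵀ * c⁻¹ * S = K * P * Hᵀ := by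
    rw [hSd, hKd, mul_add, add_mul, add_mul, Matrix.nonsing_inv_mul _ (PosDef.det' hP),
      Matrix.mul_assoc Hᵀ c⁻¹ c, Matrix.nonsing_inv_mul _ (PosDef.det' hc)]
    simp only [Matrix.mul_assoc, mul_one, one_mul]
  have h2 : P⁻¹ * K⁻¹ * (Hᵀ * c⁻¹ * S) = Hᵀ := by
    rw [h1]
    calc P⁻¹ * K⁻¹ * (K * P * Hᵀ) = P⁻¹ * (K⁻¹ * K) * P * Hᵀ := by simp only [Matrix.mul_assoc]
      _ = Hᵀ := by
        rw [Matrix.nonsing_inv_mul _ (PosDef.det' hK), mul_one,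
          Matrix.nonsing_inv_mul _ (PosDef.det' hP), one_mul]
  calc Hᵀ * S⁻¹ = P⁻¹ * K⁻¹ * (Hᵀ * c⁻¹ * S) * S⁻¹ := by rw [h2]
    _ = P⁻¹ * K⁻¹ * Hᵀ * c⁻¹ * (S * S⁻¹) := by simp only [Matrix.mul_assoc]
    _ = _ := by rw [Matrix.mul_nonsing_inv _ (PosDef.det' hS), mul_one]

/-- parameters induced by Markov parameters -/
def Params (N : ℕ) {d : ℕ} (Mm Mcov Gm GN Gcov : ℕ → Mat d) : Prop :=
  (∀ k, 1 ≤ k → k ≤ N → (Mcov k).PosDef) ∧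
  (∀ k, 1 ≤ k → k ≤ N - 1 →
    Gcov k = ((Mcov k)⁻¹ +
      (MNk d Mm N k)ᵀ * (CNk d Mm Mcov N k)⁻¹ * MNk d Mm N k)⁻¹ ∧
    GN k = Gcov k * (MNk d Mm N k)ᵀ * (CNk d Mm Mcov N k)⁻¹ ∧
    Gm k = Mm k - GN k * MNk d Mm N k * Mm k)

variable {Mm Mcov Gm GN Gcov : ℕ → Mat d}

lemma Params.gcov (h : Params N Mm Mcov Gm GN Gcov) {k : ℕ} (h1 : 1 ≤ k) (h2 : k < N) :
    (Gcov k).PosDef := by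
  rw [(h.2 k h1 (by omega)).1]
  exact (gcov_posDef (h.1 k h1 h2.le) (CNk_posDef _ _ h.1 (N - 1 - k) k (by omega))).inv

lemma Params.gcov_inv (h : Params N Mm Mcov Gm GN Gcov) {k : ℕ} (h1 : 1 ≤ k) (h2 : k < N) :
    (Gcov k)⁻¹ = (Mcov k)⁻¹ + (MNk d Mm N k)ᵀ * (CNk d Mm Mcov N k)⁻¹ * MNk d Mm N k := by
  rw [(h.2 k h1 (by omega)).1]
  exact Matrix.nonsing_inv_nonsing_inv _ (PosDef.det'
    (gcov_posDef (h.1 k h1 h2.le) (CNk_posDef _ _ h.1 (N - 1 - k) k (by omega))))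

lemma Params.gm (h : Params N Mm Mcov Gm GN Gcov) {k : ℕ} (h1 : 1 ≤ k) (h2 : k < N) :
    Gm k = Gcov k * (Mcov k)⁻¹ * Mm k := by
  obtain ⟨e1, e2, e3⟩ := h.2 k h1 (by omega)
  have hp := h.gcov h1 h2
  have hi := h.gcov_inv h1 h2
  rw [e3, e2]
  have : (Mcov k)⁻¹ = (Gcov k)⁻¹ - (MNk d Mm N k)ᵀ * (CNk d Mm Mcov N k)⁻¹ * MNk d Mm N k := by
    rw [hi]; abel
  rw [this, mul_sub, Matrix.mul_nonsing_inv _ (PosDef.det' hp), sub_mul, one_mul]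
  simp only [Matrix.mul_assoc]

lemma Params.gmT (h : Params N Mm Mcov Gm GN Gcov) {k : ℕ} (h1 : 1 ≤ k) (h2 : k < N) :
    (Gm k)ᵀ * (Gcov k)⁻¹ = (Mm k)ᵀ * (Mcov k)⁻¹ := by
  have hp := h.gcov h1 h2
  rw [h.gm h1 h2, Matrix.transpose_mul, Matrix.transpose_mul, PosDef.symm' hp,
    PosDef.symm' (h.1 k h1 h2.le).inv]
  rw [Matrix.mul_assoc, Matrix.mul_assoc, Matrix.mul_nonsing_inv _ (PosDef.det' hp), mul_one]

lemma Params.inv_gm (h : Params N Mm Mcov Gm GN Gcov) {k : ℕ} (h1 : 1 ≤ k) (h2 : k < N) :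
    (Gcov k)⁻¹ * Gm k = (Mcov k)⁻¹ * Mm k := by
  have hp := h.gcov h1 h2
  rw [h.gm h1 h2, ← Matrix.mul_assoc, ← Matrix.mul_assoc,
    Matrix.nonsing_inv_mul _ (PosDef.det' hp), one_mul]

lemma Params.inv_gN (h : Params N Mm Mcov Gm GN Gcov) {k : ℕ} (h1 : 1 ≤ k) (h2 : k < N) :
    (Gcov k)⁻¹ * GN k = (MNk d Mm N k)ᵀ * (CNk d Mm Mcov N k)⁻¹ := by
  have hp := h.gcov h1 h2
  rw [(h.2 k h1 (by omega)).2.1, Matrix.mul_assoc, ← Matrix.mul_assoc,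
    Matrix.nonsing_inv_mul _ (PosDef.det' hp), one_mul]

lemma Params.V_last (hN : 1 ≤ N) :
    (MNk d Mm N (N - 1))ᵀ * (CNk d Mm Mcov N (N - 1))⁻¹ = (Mm N)ᵀ * (Mcov N)⁻¹ := by
  rw [MNk_step Mm (show N - 1 < N by omega), CNk_last _ _ hN, Nat.sub_add_cancel hN, MNk_self,
    one_mul]

lemma Params.V_step (h : Params N Mm Mcov Gm GN Gcov) {i : ℕ} (h2 : i + 1 < N) :
    (MNk d Mm N i)ᵀ * (CNk d Mm Mcov N i)⁻¹ = (Mm (i + 1))ᵀ * (Mcov (i + 1))⁻¹ * GN (i + 1) := by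
  obtain ⟨e1, e2, e3⟩ := h.2 (i + 1) (by omega) (by omega)
  rw [MNk_step Mm (show i < N by omega), CNk_step Mm Mcov h2, Matrix.transpose_mul,
    Matrix.mul_assoc, key_identity (h.1 (i + 1) (by omega) (by omega))
      (CNk_posDef _ _ h.1 (N - 1 - (i + 1)) (i + 1) (by omega)), ← e1, e2]
  simp only [Matrix.mul_assoc]

/-- the middle block rows of the precision matrix -/
lemma Params.precision (h : Params N Mm Mcov Gm GN Gcov) {i j : ℕ} (h1 : 1 ≤ i) (h2 : i < N)
    (hj : j ≤ N) :
    bl ((Tm N Gm GN)ᵀ * (blockDiag N d (fun k => (Gcov k)⁻¹) * Tm N Gm GN)) i j =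
      if j = i then (Mcov i)⁻¹ + (Mm (i + 1))ᵀ * (Mcov (i + 1))⁻¹ * Mm (i + 1) else
      if j = i - 1 then -((Mcov i)⁻¹ * Mm i) else
      if j = i + 1 then -((Mm (i + 1))ᵀ * (Mcov (i + 1))⁻¹) else 0 := by
  rw [bl_TmT_mul Gm GN _ h1 h2, bl_diag_mul _ _ h2.le, Tm, bl_ofB _ h2.le hj]
  have hTi : (Gcov i)⁻¹ * Tb N Gm GN i j = (if j = i then (Gcov i)⁻¹ else 0) +
      (if j = i - 1 then -((Mcov i)⁻¹ * Mm i) else 0) +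
      (if j = N then -((MNk d Mm N i)ᵀ * (CNk d Mm Mcov N i)⁻¹) else 0) := by
    unfold Tb
    rw [if_pos (show 1 ≤ i ∧ i < N from ⟨h1, h2⟩), if_pos h2, mul_add, mul_add]
    simp only [mul_ite, mul_zero, mul_one, mul_neg, h.inv_gm h1 h2, h.inv_gN h1 h2]
  rw [hTi, h.gcov_inv h1 h2]
  by_cases hi : i + 1 < N
  · rw [if_pos hi, bl_diag_mul _ _ hi.le, bl_ofB _ hi.le hj, ← Matrix.mul_assoc,
      h.gmT (by omega) hi, h.V_step hi]
    unfold Tb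
    rw [if_pos (show 1 ≤ i + 1 ∧ i + 1 < N by omega), if_pos hi, Nat.add_sub_cancel]
    have hb : (Mm (i + 1))ᵀ * (Mcov (i + 1))⁻¹ * Gm (i + 1) +
        (Mm (i + 1))ᵀ * (Mcov (i + 1))⁻¹ * GN (i + 1) * MNk d Mm N i =
        (Mm (i + 1))ᵀ * (Mcov (i + 1))⁻¹ * Mm (i + 1) := by
      rw [(h.2 (i + 1) (by omega) (by omega)).2.2, MNk_step Mm h2]
      simp only [mul_sub, Matrix.mul_assoc]
      abel
    by_cases c1 : j = i
    · rw [← hb]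
      simp only [c1, if_true, if_neg (show ¬ i = i - 1 by omega), if_neg (show ¬ i = i + 1 by omega),
        if_neg (show ¬ i = N by omega), mul_neg, add_zero, zero_add]
      abel
    by_cases c2 : j = i - 1
    · simp only [c2, if_true, if_neg (show ¬ i - 1 = i by omega),
        if_neg (show ¬ i - 1 = i + 1 by omega),
        if_neg (show ¬ i - 1 = N by omega), mul_neg, add_zero, zero_add, mul_zero, sub_zero]
    by_cases c3 : j = i + 1
    · simp only [c3, if_true, if_neg (show ¬ i + 1 = i by omega),
        if_neg (show ¬ i + 1 = i - 1 by omega),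
        if_neg (show ¬ i + 1 = N by omega), mul_neg, add_zero, zero_add, mul_zero, mul_one, zero_sub]
    simp only [c1, c2, c3, if_false]
    by_cases c4 : j = N <;> simp [c4]
  · have hiN : i = N - 1 := by omega
    have hV : (MNk d Mm N i)ᵀ * (CNk d Mm Mcov N i)⁻¹ = (Mm N)ᵀ * (Mcov N)⁻¹ := by
      rw [hiN]; exact Params.V_last (by omega)
    have hH : MNk d Mm N i = Mm N := by
      rw [MNk_step Mm h2, show i + 1 = N by omega, MNk_self, one_mul]
    rw [if_neg hi, hV, hH, show i + 1 = N by omega, sub_zero]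
    by_cases c1 : j = i
    · simp only [c1, if_true, if_neg (show ¬ i = i - 1 by omega),
        if_neg (show ¬ i = N by omega), add_zero]
    by_cases c2 : j = i - 1
    · simp only [c2, if_true, if_neg (show ¬ i - 1 = i by omega),
        if_neg (show ¬ i - 1 = N by omega), add_zero, zero_add]
    simp only [c1, c2, if_false, zero_add]

lemma cyc_of_model {C : Matrix (Fin (N + 1) × Fin d) (Fin (N + 1) × Fin d) ℝ}
    (h : Params N Mm Mcov Gm GN Gcov) (hG : ∀ k, k ≤ N → (Gcov k).PosDef)
    (hT : Tm N Gm GN * C * (Tm N Gm GN)ᵀ = blockDiag N d Gcov) : Cyc N d C⁻¹ := by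
  have h1 := diag_inv_mul hG
  rw [← hT, Matrix.mul_assoc, ← Matrix.mul_assoc] at h1
  rw [← Matrix.mul_assoc] at h1
  have h2 := mul_eq_one_comm.1 h1
  have h3 : C⁻¹ = (Tm N Gm GN)ᵀ * (blockDiag N d (fun k => (Gcov k)⁻¹) * Tm N Gm GN) := by
    apply Matrix.inv_eq_left_inv
    rw [← h2]
    simp only [Matrix.mul_assoc]
  rintro ⟨p, a⟩ ⟨q, b⟩ hp hpN c1 c2 c3
  have := h.precision (i := p) (j := q) hp hpN (Nat.lt_succ_iff.1 q.2)
  simp only at c1 c2 c3 hp hpN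
  rw [← h3, if_neg c2, if_neg (by omega), if_neg c3] at this
  rw [← bl_apply C⁻¹, this]
  rfl

end Params

section Forward

variable {N d : ℕ}

lemma sum_posDef {A : Matrix (Fin (N + 1) × Fin d) (Fin (N + 1) × Fin d) ℝ} (hA : A.PosDef)
    (U : ℕ → Mat d) {k : ℕ} (hk : k ≤ N) (hU : U k = 1) :
    (∑ i ∈ Finset.range (N + 1), (U i)ᵀ *
      ∑ j ∈ Finset.range (N + 1), bl A i j * U j).PosDef := by
  let B : Matrix (Fin (N + 1) × Fin d) (Fin d) ℝ := fun p b => U p.1 p.2 b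
  have hB : Function.Injective B.mulVec := by
    intro v w hvw
    ext a
    have := congrFun hvw (Fin.ofNat (N + 1) k, a)
    have h2 : ∀ v : Fin d → ℝ, B.mulVec v (Fin.ofNat (N + 1) k, a) = v a := by
      intro v
      change (U ((Fin.ofNat (N + 1) k : Fin (N + 1)) : ℕ)).mulVec v a = v a
      rw [ofNat_val_le hk, hU, Matrix.one_mulVec]
    rwa [h2, h2] at this
  have := hA.conjTranspose_mul_mul_same hB
  rw [Matrix.conjTranspose_eq_transpose_of_trivial, Matrix.mul_assoc] at this
  convert this using 1
  ext a b
  rw [Finset.sum_range, Matrix.sum_apply]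
  simp only [Matrix.mul_apply, Fintype.sum_prod_type, Finset.sum_range, Matrix.sum_apply, bl,
    ofNat_val_fin, Matrix.transpose_apply]
  rfl

/-- backward Riccati-type recursion -/
noncomputable def Rt (N : ℕ) {d : ℕ} (q : ℕ → ℕ → Mat d) : ℕ → Mat d
  | 0 => q N N
  | t + 1 => q (N - (t + 1)) (N - (t + 1)) -
      q (N - (t + 1)) (N - t) * (Rt N q t)⁻¹ * q (N - t) (N - (t + 1))

lemma Rt_step (q : ℕ → ℕ → Mat d) {k : ℕ} (hk : k < N) :
    Rt N q (N - k) = q k k - q k (k + 1) * (Rt N q (N - (k + 1)))⁻¹ * q (k + 1) k := by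
  have h1 : N - k = (N - (k + 1)) + 1 := by omega
  rw [h1, Rt]
  have h2 : N - (N - (k + 1) + 1) = k := by omega
  have h3 : N - (N - (k + 1)) = k + 1 := by omega
  rw [h2, h3]

lemma Rt_posDef {Q : Matrix (Fin (N + 1) × Fin d) (Fin (N + 1) × Fin d) ℝ} (hQ : Q.PosDef)
    (hc : ∀ i j, i ≤ N → j ≤ N → 1 ≤ i → i < N → j + 1 ≠ i → j ≠ i → j ≠ i + 1 → bl Q i j = 0)
    (hs : ∀ i j, (bl Q i j)ᵀ = bl Q j i) {k : ℕ} (h1 : 1 ≤ k) (hk : k ≤ N) :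
    (Rt N (bl Q) (N - k)).PosDef := by
  have main : ∀ t k, 1 ≤ k → k + t = N → (Rt N (bl Q) (N - k)).PosDef ∧
      ∃ U : ℕ → Mat d, (∀ n, n < k → U n = 0) ∧ U k = 1 ∧
        (∑ n ∈ Finset.range (N + 1), bl Q k n * U n = Rt N (bl Q) (N - k)) ∧
        (∀ i, k < i → i ≤ N → ∑ n ∈ Finset.range (N + 1), bl Q i n * U n = 0) := by
    have hpd : ∀ k, 1 ≤ k → k ≤ N → (∃ U : ℕ → Mat d, (∀ n, n < k → U n = 0) ∧ U k = 1 ∧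
        (∑ n ∈ Finset.range (N + 1), bl Q k n * U n = Rt N (bl Q) (N - k)) ∧
        (∀ i, k < i → i ≤ N → ∑ n ∈ Finset.range (N + 1), bl Q i n * U n = 0)) →
        (Rt N (bl Q) (N - k)).PosDef := by
      rintro k h1 hk ⟨U, hU0, hU1, hUk, hUi⟩
      have := sum_posDef hQ U hk hU1
      rw [Finset.sum_eq_single k] at this
      · rw [hUk, hU1, Matrix.transpose_one, one_mul] at this
        exact this
      · intro i hi hik
        rcases Nat.lt_or_gt_of_ne hik with h | h
        · rw [hU0 i h]; simp
        · rw [hUi i h (by simpa [Nat.lt_succ_iff] using hi), mul_zero]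
      · intro h
        exact absurd (Finset.mem_range.2 (Nat.lt_succ_of_le hk)) h
    intro t
    induction t with
    | zero =>
      intro k h1 hk
      refine (fun h => ⟨hpd k h1 (by omega) h, h⟩) ?_
      have : k = N := by omega
      subst this
      refine ⟨fun n => if n = k then 1 else 0, fun n hn => if_neg (by omega), if_pos rfl, ?_,
        fun i h1 h2 => by omega⟩
      simp only [mul_ite, mul_one, mul_zero, Finset.sum_ite_eq', Finset.mem_range]
      rw [if_pos (by omega), Nat.sub_self, Rt]
    | succ t ih =>
      intro k h1 hk
      refine (fun h => ⟨hpd k h1 (by omega) h, h⟩) ?_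
      obtain ⟨hR, U, hU0, hU1, hUk, hUi⟩ := ih (k + 1) (by omega) (by omega)
      set R := Rt N (bl Q) (N - (k + 1)) with hRd
      have hrow : ∀ i, ∑ n ∈ Finset.range (N + 1), bl Q i n *
          ((if n = k then 1 else 0) + U n * (-(R⁻¹ * bl Q (k + 1) k))) =
          bl Q i k + (∑ n ∈ Finset.range (N + 1), bl Q i n * U n) * (-(R⁻¹ * bl Q (k + 1) k)) := by
        intro i
        simp only [mul_add, Finset.sum_add_distrib, mul_ite, mul_one, mul_zero,
          Finset.sum_ite_eq', Finset.mem_range, Finset.sum_mul]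
        rw [if_pos (by omega)]
        simp only [Matrix.mul_assoc]
      refine ⟨fun n => (if n = k then 1 else 0) + U n * (-(R⁻¹ * bl Q (k + 1) k)), ?_, ?_, ?_, ?_⟩
      · intro n hn
        beta_reduce
        rw [if_neg (by omega), hU0 n (by omega), zero_mul, add_zero]
      · beta_reduce
        rw [if_pos rfl, hU0 k (by omega), zero_mul, add_zero]
      · rw [hrow, Rt_step _ (by omega), Finset.sum_eq_single (k + 1), hU1, mul_one, mul_neg,
          ← Matrix.mul_assoc, sub_eq_add_neg]
        · intro n hn hnk
          have hn' : n ≤ N := by simpa [Nat.lt_succ_iff] using hn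
          rcases Nat.lt_or_ge n (k + 1) with h | h
          · rw [hU0 n h, mul_zero]
          · rw [hc k n (by omega) hn' h1 (by omega) (by omega) (by omega) (by omega), zero_mul]
        · intro h
          exact absurd (Finset.mem_range.2 (by omega)) h
      · intro i hi hiN
        rw [hrow]
        rcases Nat.eq_or_lt_of_le (Nat.succ_le_of_lt hi) with h | h
        · have : i = k + 1 := h.symm
          rw [this, hUk, mul_neg, ← Matrix.mul_assoc,
            Matrix.mul_nonsing_inv _ (PosDef.det' hR), one_mul, add_neg_cancel]
        · have h : k + 1 < i := h
          rw [hUi i h hiN, zero_mul, add_zero, ← hs,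
            hc k i (by omega) hiN h1 (by omega) (by omega) (by omega) (by omega),
            Matrix.transpose_zero]
  exact (main (N - k) k h1 (by omega)).1

lemma exists_params {C : Matrix (Fin (N + 1) × Fin d) (Fin (N + 1) × Fin d) ℝ} (hN : 3 ≤ N)
    (hC : C.PosDef) (hcyc : Cyc N d C⁻¹) :
    ∃ Mm Mcov Gm GN Gcov : ℕ → Mat d, Params N Mm Mcov Gm GN Gcov ∧
      (∀ k, k ≤ N → (Gcov k).PosDef) ∧
      Tm N Gm GN * C * (Tm N Gm GN)ᵀ = blockDiag N d Gcov := by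
  set Q := C⁻¹ with hQd
  have hQ : Q.PosDef := hC.inv
  have hs : ∀ i j, (bl Q i j)ᵀ = bl Q j i := by
    intro i j
    rw [← bl_transpose, PosDef.symm' hQ]
  have hCs : ∀ i j, (bl C i j)ᵀ = bl C j i := by
    intro i j
    rw [← bl_transpose, PosDef.symm' hC]
  have hc : ∀ i j, i ≤ N → j ≤ N → 1 ≤ i → i < N → j + 1 ≠ i → j ≠ i → j ≠ i + 1 →
      bl Q i j = 0 := by
    intro i j hi hj h1 h2 h3 h4 h5
    ext a b
    apply hcyc <;> simp only [ofNat_val_le hi, ofNat_val_le hj] <;> assumption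
  let R : ℕ → Mat d := fun k => Rt N (bl Q) (N - k)
  have hR : ∀ k, 1 ≤ k → k ≤ N → (R k).PosDef := fun k h1 h2 => Rt_posDef hQ hc hs h1 h2
  let Mcov : ℕ → Mat d := fun k => (R k)⁻¹
  let Mm : ℕ → Mat d := fun k => -((R k)⁻¹ * bl Q k (k - 1))
  let Gcov : ℕ → Mat d := fun k => if k = 0 then bl C 0 0 - bl C 0 N * (bl C N N)⁻¹ * bl C N 0 else
    if k = N then bl C N N else
    ((Mcov k)⁻¹ + (MNk d Mm N k)ᵀ * (CNk d Mm Mcov N k)⁻¹ * MNk d Mm N k)⁻¹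
  let GN : ℕ → Mat d := fun k => if k = 0 then bl C 0 N * (bl C N N)⁻¹ else
    Gcov k * (MNk d Mm N k)ᵀ * (CNk d Mm Mcov N k)⁻¹
  let Gm : ℕ → Mat d := fun k => Mm k - GN k * MNk d Mm N k * Mm k
  have hP : Params N Mm Mcov Gm GN Gcov := by
    refine ⟨fun k h1 h2 => (hR k h1 h2).inv, fun k h1 h2 => ⟨?_, ?_, rfl⟩⟩
    · simp only [Gcov]
      rw [if_neg (by omega), if_neg (by omega)]
    · simp only [GN]
      rw [if_neg (by omega)]
  have hNN : (bl C N N).PosDef := by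
    have := sum_posDef hC (fun n => if n = N then (1 : Mat d) else 0) le_rfl (if_pos rfl)
    simpa [ite_mul, mul_ite, Finset.sum_ite_eq', apply_ite] using this
  have h00 : (bl C 0 0 - bl C 0 N * (bl C N N)⁻¹ * bl C N 0).PosDef := by
    have := sum_posDef hC (fun n => (if n = 0 then (1 : Mat d) else 0) +
      (if n = N then -((bl C N N)⁻¹ * bl C N 0) else 0)) (Nat.zero_le _)
      (by rw [if_pos rfl, if_neg (by omega), add_zero])
    have hrow : ∀ i, ∑ j ∈ Finset.range (N + 1), bl C i j * ((if j = 0 then (1 : Mat d) else 0) +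
      (if j = N then -((bl C N N)⁻¹ * bl C N 0) else 0)) =
        bl C i 0 - bl C i N * ((bl C N N)⁻¹ * bl C N 0) := by
      intro i
      simp only [mul_add, mul_ite, mul_one, mul_zero, Finset.sum_add_distrib, Finset.sum_ite_eq',
        Finset.mem_range]
      rw [if_pos (by omega), if_pos (by omega), mul_neg, sub_eq_add_neg]
    simp only [hrow] at this
    rw [Finset.sum_eq_single 0] at this
    · rw [if_pos rfl, if_neg (by omega), add_zero, Matrix.transpose_one, one_mul,
        ← Matrix.mul_assoc] at this
      exact this
    · intro i _ hi0
      by_cases hi : i = N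
      · rw [hi, ← Matrix.mul_assoc, Matrix.mul_nonsing_inv _ (PosDef.det' hNN), one_mul, sub_self,
          mul_zero]
      · rw [if_neg hi0, if_neg hi]; simp
    · simp
  have hG : ∀ k, k ≤ N → (Gcov k).PosDef := by
    intro k hk
    by_cases h0 : k = 0
    · simp only [Gcov]; rw [if_pos h0]; exact h00
    by_cases h1 : k = N
    · simp only [Gcov]; rw [if_neg h0, if_pos h1]; exact hNN
    exact hP.gcov (by omega) (by omega)
  refine ⟨Mm, Mcov, Gm, GN, Gcov, hP, hG, ?_⟩
  -- middle rows of the precision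
  have hMi : ∀ k, 1 ≤ k → k ≤ N → (Mcov k)⁻¹ = R k := fun k h1 h2 =>
    Matrix.nonsing_inv_nonsing_inv _ (PosDef.det' (hR k h1 h2))
  have hpM : ∀ k, 1 ≤ k → k ≤ N → (Mcov k)⁻¹ * Mm k = -bl Q k (k - 1) := by
    intro k h1 h2
    rw [hMi k h1 h2]
    simp only [Mm]
    rw [mul_neg, ← Matrix.mul_assoc, Matrix.mul_nonsing_inv _ (PosDef.det' (hR k h1 h2)), one_mul]
  have hMp : ∀ k, 1 ≤ k → k ≤ N → (Mm k)ᵀ * (Mcov k)⁻¹ = -bl Q (k - 1) k := by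
    intro k h1 h2
    have := congrArg Matrix.transpose (hpM k h1 h2)
    rw [Matrix.transpose_mul, PosDef.symm' ((hP.1 k h1 h2).inv), Matrix.transpose_neg (bl Q k (k - 1)),
      hs] at this
    exact this
  set W := (Tm N Gm GN)ᵀ * (blockDiag N d (fun k => (Gcov k)⁻¹) * Tm N Gm GN) with hW
  have hWQ : ∀ i j, 1 ≤ i → i < N → j ≤ N → bl W i j = bl Q i j := by
    intro i j h1 h2 hj
    rw [hW, hP.precision h1 h2 hj, hpM i h1 h2.le, hMp (i + 1) (by omega) (by omega),
      hMi i h1 h2.le]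
    by_cases c1 : j = i
    · rw [if_pos c1, c1]
      simp only [R, Mm]
      rw [Rt_step _ h2, Nat.add_sub_cancel, neg_mul_neg, ← Matrix.mul_assoc]
      abel
    rw [if_neg c1]
    by_cases c2 : j = i - 1
    · rw [if_pos c2, c2, neg_neg]
    rw [if_neg c2]
    by_cases c3 : j = i + 1
    · rw [if_pos c3, c3, neg_neg, Nat.add_sub_cancel]
    rw [if_neg c3, hc i j h2.le hj h1 h2 (by omega) c1 c3]
  have hWC : ∀ i j, 1 ≤ i → i < N → j ≤ N → bl (W * C) i j = if i = j then 1 else 0 := by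
    intro i j h1 h2 hj
    rw [← bl_one h2.le hj, ← Matrix.nonsing_inv_mul C (PosDef.det' hC), ← hQd, bl_mul, bl_mul]
    refine Finset.sum_congr rfl fun k hk => ?_
    rw [hWQ i k h1 h2 (by simpa [Nat.lt_succ_iff] using hk)]
  set A := Tm N Gm GN * C with hA
  have hrec : ∀ i j, 1 ≤ i → i < N → j ≤ N → (Gcov i)⁻¹ * bl A i j =
      (if i = j then 1 else 0) +
        (if i + 1 < N then (Gm (i + 1))ᵀ * ((Gcov (i + 1))⁻¹ * bl A (i + 1) j) else 0) := by
    intro i j h1 h2 hj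
    rw [← hWC i j h1 h2 hj]
    have : W * C = (Tm N Gm GN)ᵀ * (blockDiag N d (fun k => (Gcov k)⁻¹) * A) := by
      rw [hW, hA]; simp only [Matrix.mul_assoc]
    rw [this, bl_TmT_mul Gm GN _ h1 h2, bl_diag_mul _ _ h2.le]
    split_ifs with h
    · rw [bl_diag_mul _ _ h.le]; abel
    · simp
  have hz : ∀ t i j, 1 ≤ i → i + t + 1 = N → (j < i ∨ j = N) → (Gcov i)⁻¹ * bl A i j = 0 := by
    intro t
    induction t with
    | zero =>
      intro i j h1 h2 hj
      rw [hrec i j h1 (by omega) (by omega), if_neg (by omega), if_neg (by omega), add_zero]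
    | succ t ih =>
      intro i j h1 h2 hj
      rw [hrec i j h1 (by omega) (by omega), if_neg (by omega), if_pos (by omega),
        ih (i + 1) j (by omega) (by omega) (by omega), mul_zero, add_zero]
  have hcancel : ∀ i, i ≤ N → ∀ X Y : Mat d, (Gcov i)⁻¹ * X = Y → X = Gcov i * Y := by
    intro i hi X Y h
    rw [← h, ← Matrix.mul_assoc, Matrix.mul_nonsing_inv _ (PosDef.det' (hG i hi)), one_mul]
  have hA0 : ∀ i j, 1 ≤ i → i < N → (j < i ∨ j = N) → bl A i j = 0 := by
    intro i j h1 h2 hj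
    rw [hcancel i h2.le _ _ (hz (N - 1 - i) i j h1 (by omega) hj), mul_zero]
  have hA1 : ∀ i, 1 ≤ i → i < N → bl A i i = Gcov i := by
    intro i h1 h2
    have := hrec i i h1 h2 h2.le
    rw [if_pos rfl] at this
    rw [hcancel i h2.le _ _ this]
    split_ifs with h
    · rw [hz (N - 1 - (i + 1)) (i + 1) i (by omega) (by omega) (by omega), mul_zero, add_zero,
        mul_one]
    · rw [add_zero, mul_one]
  have hgN0 : GN 0 = bl C 0 N * (bl C N N)⁻¹ := by simp only [GN, if_true]
  have hA0j : ∀ j, bl A 0 j = bl C 0 j - bl C 0 N * (bl C N N)⁻¹ * bl C N j := by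
    intro j
    rw [hA, bl_Tm_mul _ _ _ (Nat.zero_le _), if_neg (by omega), if_pos (by omega), hgN0, zero_mul,
      add_zero, neg_mul, sub_eq_add_neg]
  have hA0N : bl A 0 N = 0 := by
    rw [hA0j, Matrix.mul_assoc, Matrix.nonsing_inv_mul _ (PosDef.det' hNN), mul_one, sub_self]
  have hANN : bl A N N = bl C N N := by
    rw [hA, bl_Tm_mul _ _ _ le_rfl, if_neg (by omega), if_neg (by omega)]
    simp
  have hE : ∀ i j, i ≤ N → j ≤ N → ((1 ≤ i ∧ i < N ∧ (j ≤ i ∨ j = N)) ∨ (i = N ∧ j = N) ∨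
      (i = 0 ∧ (j = N ∨ j = 0))) →
      bl (A * (Tm N Gm GN)ᵀ) i j = if i = j then Gcov i else 0 := by
    intro i j hi hj h
    rw [bl_mul_TmT _ _ _ hj]
    rcases h with ⟨h1, h2, h3⟩ | ⟨h1, h2⟩ | ⟨h1, h2⟩
    · rw [hA0 i N h1 h2 (Or.inr rfl), zero_mul, add_zero]
      by_cases hij : i = j
      · rw [if_pos hij, ← hij, hA1 i h1 h2, hA0 i (i - 1) h1 h2 (by omega), zero_mul, add_zero]
      · rw [if_neg hij, hA0 i j h1 h2 (by omega), zero_add]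
        by_cases hjN : j = N
        · rw [if_neg (show ¬ (1 ≤ j ∧ j < N) by omega)]; simp
        · rw [hA0 i (j - 1) h1 h2 (by omega), zero_mul]
    · rw [h1, h2, hANN, if_neg (by omega), if_neg (by omega), if_pos rfl]
      simp only [Gcov]
      rw [if_neg (by omega), if_true]
      simp
    · rw [h1, hA0N, zero_mul, add_zero, if_neg (show ¬ (1 ≤ j ∧ j < N) by omega)]
      rcases h2 with h2 | h2
      · rw [h2, hA0N, if_neg (by omega)]; simp
      · rw [h2, hA0j]
        simp [Gcov]
  refine bl_ext fun i j hi hj => ?_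
  rw [bl_blockDiag _ hi hj]
  have hsym : (A * (Tm N Gm GN)ᵀ)ᵀ = A * (Tm N Gm GN)ᵀ := by
    rw [hA]
    simp only [Matrix.transpose_mul, Matrix.transpose_transpose, PosDef.symm' hC, Matrix.mul_assoc]
  by_cases h : (1 ≤ i ∧ i < N ∧ (j ≤ i ∨ j = N)) ∨ (i = N ∧ j = N) ∨ (i = 0 ∧ (j = N ∨ j = 0))
  · exact hE i j hi hj h
  · have := hE j i hj hi (by omega)
    rw [← hsym, bl_transpose, this]
    by_cases hij : i = j
    · omega
    · rw [if_neg hij, if_neg (Ne.symm hij), Matrix.transpose_zero]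

end Forward

/-- **Markov-induced CM_L model.** A zero-mean nonsingular Gaussian
sequence `[x_k]`, `k ∈ [0,N]`, is reciprocal iff it obeys a CM_L model whose
parameters `(G_{k,k-1}, G_{k,N}, G_k)`, `k ∈ [1,N-1]`, are given, for some `d × d`
matrices `M_{k,k-1}` and positive definite `M_k` (`k ∈ [1,N]`), by
`G_k = (M_k⁻¹ + M_{N|k}' C_{N|k}⁻¹ M_{N|k})⁻¹`, `G_{k,N} = G_k M_{N|k}' C_{N|k}⁻¹`,
and `G_{k,k-1} = M_{k,k-1} - G_{k,N} M_{N|k} M_{k,k-1}`. -/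
theorem stmt10 {N d : ℕ} (hN : 3 ≤ N) (hd : 1 ≤ d)
    (μ : Measure Ω) [IsProbabilityMeasure μ] (x : ℕ → Ω → Fin d → ℝ)
    (C : Matrix (Fin (N + 1) × Fin d) (Fin (N + 1) × Fin d) ℝ)
    (hx : ZMNG N d μ x C) :
    IsReciprocal μ x N ↔
      ∃ Mm Mcov Gm GN Gcov : ℕ → Mat d,
        (∀ k, 1 ≤ k → k ≤ N → (Mcov k).PosDef) ∧
        (∀ k, 1 ≤ k → k ≤ N - 1 →
          Gcov k = ((Mcov k)⁻¹ +
            (MNk d Mm N k)ᵀ * (CNk d Mm Mcov N k)⁻¹ * MNk d Mm N k)⁻¹ ∧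
          GN k = Gcov k * (MNk d Mm N k)ᵀ * (CNk d Mm Mcov N k)⁻¹ ∧
          Gm k = Mm k - GN k * MNk d Mm N k * Mm k) ∧
        CMLModel N d μ x Gm GN Gcov := by
  constructor
  · intro hr
    obtain ⟨Mm, Mcov, Gm, GN, Gcov, hP, hG, hT⟩ :=
      exists_params hN hx.2.2 (cyc_of_recip hx hr)
    exact ⟨Mm, Mcov, Gm, GN, Gcov, hP.1, hP.2, model_of_cov hN hx hG hT⟩
  · rintro ⟨Mm, Mcov, Gm, GN, Gcov, h1, h2, hm⟩
    have hP : Params N Mm Mcov Gm GN Gcov := ⟨h1, h2⟩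
    have hG : ∀ k, k ≤ N → (Gcov k).PosDef := by
      obtain ⟨e, -, hG, -⟩ := hm
      exact hG
    exact recip_of_cyc hx (cyc_of_model hP hG (cov_of_model hN hx hm))

end CMSeqPaper
end
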